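/- arXiv:1212.5099 — 3 statements merged into one kernel-verified Lean document; each statement's English description precedes it below -/
import Mathlib

section
/- Let n ≥ 1 and for b > −n let M_b = ∫_{ℝ^n} |y|^b v_∞(y) dy (a finite integral). Then: M_b > 0 for all b ∈ (−n, 2) ∪ ⋃_{k=0}^∞ (8k+6, 8k+10); M_b = 0 for all b of the form b = 4j+2 with j ∈ ℕ; and M_b < 0 for all b ∈ ⋃_{k=0}^∞ (8k+2, 8k+6). -/
open MeasureTheory Real Filter Topology

noncomputable def besselJ (ν y : ℝ) : ℝ :=
  ∑' k : ℕ, (-1 : ℝ) ^ k * (y / 2) ^ ((2 * k : ℝ) + ν) /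
    (Nat.factorial k * Real.Gamma ((k : ℝ) + ν + 1))

noncomputable def fmn (m n : ℕ) (η : ℝ) : ℝ :=
  η ^ ((1 : ℝ) - n) *
    ∫ s in Set.Ioi (0 : ℝ),
      Real.exp (-(s ^ (2 * m))) * (η * s) ^ ((n : ℝ) / 2) *
        besselJ (((n : ℝ) - 2) / 2) (η * s)
/-- The rescaled biharmonic heat kernel `v_∞(y) = 2^{n/2} α_n f_n(√2 |y|)`. -/
noncomputable def vinf (n : ℕ) (α : ℝ) (y : EuclideanSpace ℝ (Fin n)) : ℝ :=
  2 ^ ((n : ℝ) / 2) * α * fmn 2 n (Real.sqrt 2 * ‖y‖)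

noncomputable def hkW (u : ℝ) : ℂ := 1 + u * Complex.I

noncomputable def hkE (u : ℝ) : ℂ := Complex.exp (hkW u ^ 2)

noncomputable def hkK (p : ℝ) : ℂ := ∫ u : ℝ, hkE u * hkW u ^ (p : ℂ)

lemma hkW_re (u : ℝ) : (hkW u).re = 1 := by simp [hkW]

lemma hkW_im (u : ℝ) : (hkW u).im = u := by simp [hkW]

lemma hkW_ne (u : ℝ) : hkW u ≠ 0 := by
  intro h
  have := hkW_re u
  rw [h] at this
  simp at this

lemma hkW_slit (u : ℝ) : hkW u ∈ Complex.slitPlane := by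
  left
  rw [hkW_re]
  exact one_pos

lemma hkW_norm_sq (u : ℝ) : ‖hkW u‖ ^ 2 = 1 + u ^ 2 := by
  rw [Complex.sq_norm, Complex.normSq_apply, hkW_re, hkW_im]
  ring

lemma hkW_norm_ge (u : ℝ) : 1 ≤ ‖hkW u‖ := by
  have := hkW_norm_sq u
  nlinarith [norm_nonneg (hkW u), sq_nonneg u]

lemma hkE_norm (u : ℝ) : ‖hkE u‖ = Real.exp (1 - u ^ 2) := by
  rw [hkE, Complex.norm_exp]
  congr 1
  simp [hkW, pow_two]

lemma hkW_cont : Continuous hkW := by unfold hkW; fun_prop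

lemma hkE_cont : Continuous hkE := by
  unfold hkE
  exact Complex.continuous_exp.comp (hkW_cont.pow 2)

lemma hkWp_cont (p : ℂ) : Continuous (fun u => hkW u ^ p) :=
  hkW_cont.cpow continuous_const hkW_slit

/-- polynomial growth against a Gaussian -/
lemma pow_le_exp_half (q : ℝ) : ∃ C : ℝ, 0 ≤ C ∧ ∀ y : ℝ, 1 ≤ y → y ^ q ≤ C * Real.exp (y / 2) := by
  obtain ⟨N, hN⟩ := exists_nat_ge q
  refine ⟨N.factorial * 2 ^ N, by positivity, fun y hy => ?_⟩
  have h1 : y ^ q ≤ y ^ N := by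
    rw [← Real.rpow_natCast]
    exact Real.rpow_le_rpow_of_exponent_le hy hN
  have h2 := Real.pow_div_factorial_le_exp (y / 2) (by linarith) N
  rw [div_le_iff₀ (by positivity), div_pow, div_le_iff₀ (by positivity)] at h2
  linarith

lemma gauss_pow_integrable (q : ℝ) :
    Integrable (fun u : ℝ => Real.exp (1 - u ^ 2) * (1 + u ^ 2) ^ q) := by
  obtain ⟨C, hC, h⟩ := pow_le_exp_half q
  have hg := (integrable_exp_neg_mul_sq (b := 1 / 2) (by norm_num)).const_mul
    (C * Real.exp (3 / 2))
  refine hg.mono' ?_ (ae_of_all _ fun u => ?_)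
  · apply Continuous.aestronglyMeasurable
    refine Continuous.mul (by fun_prop) (Continuous.rpow_const (by fun_prop) fun u => ?_)
    left; positivity
  · rw [Real.norm_of_nonneg (by positivity)]
    have := h (1 + u ^ 2) (by nlinarith)
    calc Real.exp (1 - u ^ 2) * (1 + u ^ 2) ^ q
        ≤ Real.exp (1 - u ^ 2) * (C * Real.exp ((1 + u ^ 2) / 2)) := by gcongr
      _ = C * (Real.exp (1 - u ^ 2) * Real.exp ((1 + u ^ 2) / 2)) := by ring
      _ = C * (Real.exp (3 / 2) * Real.exp (-(1 / 2) * u ^ 2)) := by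
        rw [← Real.exp_add, ← Real.exp_add]; congr 2; ring
      _ = _ := by ring

lemma hkW_norm_rpow (u p : ℝ) : ‖hkW u‖ ^ p = (1 + u ^ 2) ^ (p / 2) := by
  rw [← hkW_norm_sq, ← Real.rpow_natCast, ← Real.rpow_mul (norm_nonneg _)]
  congr 1
  push_cast; ring

lemma hk_norm (u p : ℝ) : ‖hkE u * hkW u ^ (p : ℂ)‖ = Real.exp (1 - u ^ 2) * (1 + u ^ 2) ^ (p / 2) := by
  rw [norm_mul, hkE_norm, Complex.norm_cpow_real, hkW_norm_rpow]

lemma hk_integrable (p : ℝ) : Integrable (fun u => hkE u * hkW u ^ (p : ℂ)) := by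
  refine (gauss_pow_integrable (p / 2)).mono' (hkE_cont.mul (hkWp_cont _)).aestronglyMeasurable
    (ae_of_all _ fun u => ?_)
  rw [hk_norm]

lemma hk_norm_le (u p : ℝ) (hp : p ≤ 0) : ‖hkE u * hkW u ^ (p : ℂ)‖ ≤ Real.exp (1 - u ^ 2) := by
  rw [norm_mul, hkE_norm, Complex.norm_cpow_real]
  exact mul_le_of_le_one_right (by positivity) (Real.rpow_le_one_of_one_le_of_nonpos (hkW_norm_ge u) hp)

lemma gauss_integrable : Integrable (fun u : ℝ => Real.exp (1 - u ^ 2)) := by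
  simpa using gauss_pow_integrable 0

lemma hkK_rec (p : ℝ) : 2 * hkK p + (p - 1) * hkK (p - 2) = 0 := by
  have hd : ∀ u : ℝ, HasDerivAt (fun u : ℝ => hkE u * hkW u ^ ((p - 1 : ℝ) : ℂ))
      (Complex.I * (2 * (hkE u * hkW u ^ (p : ℂ)) + (p - 1) * (hkE u * hkW u ^ ((p - 2 : ℝ) : ℂ)))) u := by
    intro u
    have h0 : HasDerivAt hkW Complex.I u := by
      have := ((Complex.ofRealCLM.hasDerivAt (x := u)).mul_const Complex.I).const_add 1
      refine this.congr_deriv ?_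
      simp
    have h1 : HasDerivAt hkE (Complex.exp (hkW u ^ 2) * (2 * hkW u * Complex.I)) u := by
      have := (h0.pow 2).cexp
      refine this.congr_deriv ?_
      simp
    have h2 : HasDerivAt (fun u => hkW u ^ ((p - 1 : ℝ) : ℂ))
        (((p - 1 : ℝ) : ℂ) * hkW u ^ (((p - 1 : ℝ) : ℂ) - 1) * Complex.I) u := by
      have h3 := (hasStrictDerivAt_id (𝕜 := ℂ) (hkW u)).hasDerivAt.cpow_const (c := ((p - 1 : ℝ) : ℂ)) (hkW_slit u)
      have := h3.comp u h0
      refine this.congr_deriv ?_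
      simp
    refine (h1.mul h2).congr_deriv ?_
    have e1 : hkW u ^ (p : ℂ) = hkW u * hkW u ^ ((p - 1 : ℝ) : ℂ) := by
      have := Complex.cpow_add ((p - 1 : ℝ) : ℂ) 1 (hkW_ne u)
      rw [Complex.cpow_one] at this
      rw [mul_comm, ← this]; congr 1; push_cast; ring
    have e2 : (((p - 1 : ℝ) : ℂ) - 1) = ((p - 2 : ℝ) : ℂ) := by push_cast; ring
    rw [e1, e2, hkE]
    push_cast
    ring
  have hi := (((hk_integrable p).const_mul 2).add ((hk_integrable (p - 2)).const_mul ((p : ℂ) - 1)))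
  have := integral_eq_zero_of_hasDerivAt_of_integrable hd (hi.const_mul Complex.I) (hk_integrable (p - 1))
  rw [integral_const_mul, integral_add ((hk_integrable p).const_mul 2)
    ((hk_integrable (p - 2)).const_mul ((p : ℂ) - 1)), integral_const_mul, integral_const_mul] at this
  simpa [hkK] using this

lemma hkK_contAt : ContinuousAt hkK (-1) := by
  unfold hkK
  refine continuousAt_of_dominated (bound := fun u => Real.exp (1 - u ^ 2)) ?_ ?_ gauss_integrable ?_
  · exact Eventually.of_forall fun p => (hkE_cont.mul (hkWp_cont _)).aestronglyMeasurable
  · filter_upwards [Iio_mem_nhds (show (-1 : ℝ) < 0 by norm_num)] with p hp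
    exact ae_of_all _ fun u => hk_norm_le u p (le_of_lt hp)
  · refine ae_of_all _ fun u => ?_
    refine ContinuousAt.mul continuousAt_const ?_
    exact (continuousAt_const_cpow (hkW_ne u)).comp Complex.continuous_ofReal.continuousAt

lemma gauss_pow_le (q : ℝ) : ∃ C : ℝ, 0 ≤ C ∧ ∀ u : ℝ,
    Real.exp (1 - u ^ 2) * (1 + u ^ 2) ^ q ≤ C * Real.exp (-(1 / 2) * u ^ 2) := by
  obtain ⟨C, hC, h⟩ := pow_le_exp_half q
  refine ⟨C * Real.exp (3 / 2), by positivity, fun u => ?_⟩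
  have := h (1 + u ^ 2) (by nlinarith)
  calc Real.exp (1 - u ^ 2) * (1 + u ^ 2) ^ q
      ≤ Real.exp (1 - u ^ 2) * (C * Real.exp ((1 + u ^ 2) / 2)) := by gcongr
    _ = C * (Real.exp (1 - u ^ 2) * Real.exp ((1 + u ^ 2) / 2)) := by ring
    _ = C * (Real.exp (3 / 2) * Real.exp (-(1 / 2) * u ^ 2)) := by
      rw [← Real.exp_add, ← Real.exp_add]; congr 2; ring
    _ = _ := by ring

noncomputable def hkF (p : ℝ) (z : ℂ) : ℂ := Complex.exp (z ^ 2) * z ^ (p : ℂ)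

lemma hkF_norm_le (p : ℝ) (hp : 0 < p) (x u : ℝ) (hx0 : 0 ≤ x) (hx1 : x ≤ 1) :
    ‖hkF p (x + u * Complex.I)‖ ≤ Real.exp (1 - u ^ 2) * (1 + u ^ 2) ^ (p / 2) := by
  rw [hkF, norm_mul, Complex.norm_cpow_real, Complex.norm_exp]
  have h1 : ((x + u * Complex.I : ℂ) ^ 2).re = x ^ 2 - u ^ 2 := by simp [pow_two]
  have h2 : ‖(x + u * Complex.I : ℂ)‖ ^ 2 = x ^ 2 + u ^ 2 := by
    rw [Complex.sq_norm, Complex.normSq_apply]; simp; ring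
  have h3 : ‖(x + u * Complex.I : ℂ)‖ ^ p = (x ^ 2 + u ^ 2) ^ (p / 2) := by
    rw [← h2, ← Real.rpow_natCast, ← Real.rpow_mul (norm_nonneg _)]
    congr 1
    push_cast; ring
  rw [h1, h3]
  have : x ^ 2 ≤ 1 := by nlinarith
  gcongr

lemma hkF_contAt (p : ℝ) (hp : 0 < p) (z : ℂ) (hz : 0 ≤ z.re) : ContinuousAt (hkF p) z := by
  unfold hkF
  refine ContinuousAt.mul (by fun_prop) ?_
  exact Complex.continuousAt_cpow_const_of_re_pos (Or.inl hz) (by simpa using hp)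

lemma hkF_line_cont (p : ℝ) (hp : 0 < p) : Continuous (fun u : ℝ => hkF p (u * Complex.I)) := by
  rw [continuous_iff_continuousAt]
  intro u
  exact ContinuousAt.comp (f := fun u : ℝ => (u * Complex.I : ℂ)) (hkF_contAt p hp _ (by simp)) (by fun_prop)

lemma hkF_line_integrable (p : ℝ) (hp : 0 < p) : Integrable (fun u : ℝ => hkF p (u * Complex.I)) := by
  refine (gauss_pow_integrable (p / 2)).mono' (hkF_line_cont p hp).aestronglyMeasurable
    (ae_of_all _ fun u => ?_)
  simpa using hkF_norm_le p hp 0 u le_rfl zero_le_one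

lemma hkK_shift (p : ℝ) (hp : 0 < p) : hkK p = ∫ u : ℝ, hkF p (u * Complex.I) := by
  have hrect : ∀ T : ℝ, 0 < T →
      (((∫ x : ℝ in (0:ℝ)..1, hkF p (x + (-T : ℝ) * Complex.I)) - ∫ x : ℝ in (0:ℝ)..1, hkF p (x + T * Complex.I)) +
        Complex.I • ∫ y : ℝ in (-T)..T, hkE y * hkW y ^ (p : ℂ)) -
        Complex.I • ∫ y : ℝ in (-T)..T, hkF p (y * Complex.I) = 0 := by
    intro T hT
    have := Complex.integral_boundary_rect_eq_zero_of_continuousOn_of_differentiableOn (hkF p)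
      ⟨0, -T⟩ ⟨1, T⟩ ?_ ?_
    · simpa [hkF, hkE, hkW] using this
    · intro z hz
      refine (hkF_contAt p hp z ?_).continuousWithinAt
      have := hz.1
      simp at this
      exact this.1
    · intro z hz
      have := hz.1
      simp at this
      refine DifferentiableAt.differentiableWithinAt ?_
      unfold hkF
      refine DifferentiableAt.mul (by fun_prop) ?_
      exact DifferentiableAt.cpow_const differentiableAt_id (Or.inl this.1)
  obtain ⟨C, hC, hb⟩ := gauss_pow_le (p / 2)
  have hz : Tendsto (fun T : ℝ => C * Real.exp (-(1 / 2) * T ^ 2)) atTop (𝓝 0) := by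
    rw [← mul_zero C]
    refine Tendsto.const_mul C (Real.tendsto_exp_atBot.comp ?_)
    exact (tendsto_pow_atTop two_ne_zero).const_mul_atTop_of_neg (by norm_num)
  have hedge : ∀ T : ℝ, ‖∫ x : ℝ in (0:ℝ)..1, hkF p (x + T * Complex.I)‖ ≤ C * Real.exp (-(1 / 2) * T ^ 2) := by
    intro T
    have := intervalIntegral.norm_integral_le_of_norm_le_const (a := (0:ℝ)) (b := 1)
      (f := fun x : ℝ => hkF p (x + T * Complex.I)) (C := C * Real.exp (-(1 / 2) * T ^ 2)) ?_
    · simpa using this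
    · intro x hx
      rw [Set.uIoc_of_le zero_le_one] at hx
      exact (hkF_norm_le p hp x T hx.1.le hx.2).trans (hb T)
  have e1 : Tendsto (fun T : ℝ => ∫ x : ℝ in (0:ℝ)..1, hkF p (x + T * Complex.I)) atTop (𝓝 0) :=
    squeeze_zero_norm hedge hz
  have e2 : Tendsto (fun T : ℝ => ∫ x : ℝ in (0:ℝ)..1, hkF p (x + (-T : ℝ) * Complex.I)) atTop (𝓝 0) :=
    squeeze_zero_norm (fun T => by simpa using hedge (-T)) hz
  have e3 := intervalIntegral_tendsto_integral (hk_integrable p) tendsto_neg_atTop_atBot tendsto_id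
  have e4 := intervalIntegral_tendsto_integral (hkF_line_integrable p hp) tendsto_neg_atTop_atBot tendsto_id
  have e5 := ((e2.sub e1).add (e3.const_smul Complex.I)).sub (e4.const_smul Complex.I)
  have e6 := tendsto_nhds_unique (e5.congr' (f₂ := fun _ => (0 : ℂ)) (by
    filter_upwards [eventually_gt_atTop 0] with T hT using hrect T hT)) tendsto_const_nhds
  have : Complex.I * (hkK p - ∫ u : ℝ, hkF p (u * Complex.I)) = 0 := by
    rw [← e6, hkK]; simp only [smul_eq_mul]; ring
  have := (mul_eq_zero.mp this).resolve_left Complex.I_ne_zero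
  exact sub_eq_zero.mp this

lemma hkK_pos (p : ℝ) (hp : 0 < p) :
    hkK p = ((Real.cos (π * p / 2) * Real.Gamma ((p + 1) / 2) : ℝ) : ℂ) := by
  rw [hkK_shift p hp]
  have hi := hkF_line_integrable p hp
  rw [← integral_add_compl (measurableSet_Ioi (a := (0:ℝ))) hi, Set.compl_Ioi]
  have hneg := integral_comp_neg_Ioi (0 : ℝ) (fun u : ℝ => hkF p (u * Complex.I))
  rw [neg_zero] at hneg
  rw [← hneg]
  have k1 : ∀ u ∈ Set.Ioi (0:ℝ), hkF p (u * Complex.I) =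
      Complex.exp (π / 2 * Complex.I * p) * ((u ^ p * Real.exp (- u ^ (2:ℝ)) : ℝ) : ℂ) := by
    intro u hu
    have hu : 0 < u := hu
    rw [hkF, Complex.cpow_def_of_ne_zero (by simp [hu.ne']), Complex.log_ofReal_mul hu Complex.I_ne_zero,
      Complex.log_I, Real.rpow_def_of_pos hu, Real.rpow_two]
    push_cast
    rw [add_mul, Complex.exp_add, mul_pow, Complex.I_sq]
    ring_nf
  have k2 : ∀ u ∈ Set.Ioi (0:ℝ), hkF p ((-u : ℝ) * Complex.I) =
      Complex.exp (-(π / 2 * Complex.I * p)) * ((u ^ p * Real.exp (- u ^ (2:ℝ)) : ℝ) : ℂ) := by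
    intro u hu
    have hu : 0 < u := hu
    have : ((-u : ℝ) * Complex.I : ℂ) = u * (-Complex.I) := by push_cast; ring
    rw [this, hkF, Complex.cpow_def_of_ne_zero (by simp [hu.ne']), Complex.log_ofReal_mul hu (by simp),
      Complex.log_neg_I, Real.rpow_def_of_pos hu, Real.rpow_two]
    push_cast
    rw [add_mul, Complex.exp_add, mul_pow, neg_sq, Complex.I_sq]
    ring_nf
  rw [setIntegral_congr_fun measurableSet_Ioi k1, setIntegral_congr_fun measurableSet_Ioi k2,
    integral_const_mul, integral_const_mul, integral_complex_ofReal,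
    integral_rpow_mul_exp_neg_rpow two_pos (by linarith)]
  push_cast
  rw [Complex.cos]
  have : (π * p / 2 * Complex.I : ℂ) = π / 2 * Complex.I * p := by ring
  rw [neg_mul, this]
  ring

lemma hkK_eq_pos (p : ℝ) (hp : 0 < p) : hkK p = ((π * (Real.Gamma ((1 - p) / 2))⁻¹ : ℝ) : ℂ) := by
  rw [hkK_pos p hp]
  congr 1
  have h := Real.Gamma_mul_Gamma_one_sub ((1 - p) / 2)
  have h1 : 1 - (1 - p) / 2 = (p + 1) / 2 := by ring
  have h2 : Real.sin (π * ((1 - p) / 2)) = Real.cos (π * p / 2) := by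
    rw [← Real.sin_pi_div_two_sub]; congr 1; ring
  rw [h1, h2] at h
  have hG : Real.Gamma ((p + 1) / 2) ≠ 0 := (Real.Gamma_pos_of_pos (by linarith)).ne'
  by_cases hc : Real.cos (π * p / 2) = 0
  · rw [hc, div_zero] at h
    have := (mul_eq_zero.mp h).resolve_right hG
    rw [hc, this]; simp
  · have h3 : Real.Gamma ((1 - p) / 2) ≠ 0 := by
      intro h0
      rw [h0, zero_mul] at h
      have := div_ne_zero Real.pi_ne_zero hc
      exact this h.symm
    rw [eq_div_iff hc] at h
    rw [← div_eq_mul_inv, eq_div_iff h3]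
    linarith

lemma hkK_step (p : ℝ) (hp : p ≠ 1) (h : hkK p = ((π * (Real.Gamma ((1 - p) / 2))⁻¹ : ℝ) : ℂ)) :
    hkK (p - 2) = ((π * (Real.Gamma ((1 - (p - 2)) / 2))⁻¹ : ℝ) : ℂ) := by
  have hr := hkK_rec p
  have hz : (1 - p) / 2 ≠ 0 := by
    intro h0; apply hp; linarith
  have hG : Real.Gamma ((1 - (p - 2)) / 2) = (1 - p) / 2 * Real.Gamma ((1 - p) / 2) := by
    rw [← Real.Gamma_add_one hz]; congr 1; ring
  have hp' : ((p : ℂ) - 1) ≠ 0 := by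
    intro h0
    apply hp
    have : (p : ℂ) = ((1 : ℝ) : ℂ) := by push_cast; linear_combination h0
    exact_mod_cast this
  have : hkK (p - 2) = -(2 * hkK p) / ((p : ℂ) - 1) := by
    rw [eq_div_iff hp']; linear_combination hr
  rw [this, h, hG, mul_inv]
  push_cast
  have hp2 : (1 - (p : ℂ)) ≠ 0 := by
    intro h0; apply hp'; linear_combination -h0
  field_simp
  ring

lemma hkK_eq_gt (p : ℝ) (hp : -2 < p) : hkK p = ((π * (Real.Gamma ((1 - p) / 2))⁻¹ : ℝ) : ℂ) := by
  have key : ∀ p : ℝ, -2 < p → p ≠ -1 → hkK p = ((π * (Real.Gamma ((1 - p) / 2))⁻¹ : ℝ) : ℂ) := by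
    intro p hp h1
    have := hkK_step (p + 2) (fun h => h1 (by linarith)) (hkK_eq_pos _ (by linarith))
    simpa using this
  by_cases h1 : p = -1
  · subst h1
    have c1 : Tendsto hkK (𝓝[≠] (-1)) (𝓝 (hkK (-1))) := hkK_contAt.tendsto.mono_left nhdsWithin_le_nhds
    have c2 : ContinuousAt (fun p : ℝ => ((π * (Real.Gamma ((1 - p) / 2))⁻¹ : ℝ) : ℂ)) (-1) := by
      refine Complex.continuous_ofReal.continuousAt.comp ?_
      refine continuousAt_const.mul (ContinuousAt.inv₀ ?_ ?_)
      · have : ContinuousAt Real.Gamma ((1 - (-1 : ℝ)) / 2) := by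
          refine (Real.differentiableAt_Gamma (fun m => ?_)).continuousAt
          have : (0:ℝ) ≤ m := m.cast_nonneg
          intro h; linarith
        exact ContinuousAt.comp (f := fun p : ℝ => (1 - p) / 2) this (by fun_prop)
      · exact (Real.Gamma_pos_of_pos (by norm_num)).ne'
    refine tendsto_nhds_unique c1 ((c2.tendsto.mono_left nhdsWithin_le_nhds).congr' ?_)
    filter_upwards [self_mem_nhdsWithin,
      mem_nhdsWithin_of_mem_nhds (Ioi_mem_nhds (show (-2 : ℝ) < -1 by norm_num))] with q hq hq2
    exact (key q hq2 hq).symm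
  · exact key p hp h1

/-- The Hankel-type representation of the reciprocal Gamma function along a parabola. -/
lemma hkK_eq (p : ℝ) : hkK p = ((π * (Real.Gamma ((1 - p) / 2))⁻¹ : ℝ) : ℂ) := by
  have key : ∀ (N : ℕ) (p : ℝ), -2 - 2 * (N : ℝ) < p →
      hkK p = ((π * (Real.Gamma ((1 - p) / 2))⁻¹ : ℝ) : ℂ) := by
    intro N
    induction N with
    | zero => intro p hp; exact hkK_eq_gt p (by simpa using hp)
    | succ N ih =>
      intro p hp
      by_cases h : -2 < p
      · exact hkK_eq_gt p h
      · push_cast at hp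
        have := hkK_step (p + 2) (by intro h1; linarith) (ih (p + 2) (by linarith))
        simpa using this
  obtain ⟨N, hN⟩ := exists_nat_gt (-p)
  exact key N p (by have : (0:ℝ) ≤ N := N.cast_nonneg
                    linarith)

lemma cm_integrable (s : ℝ) (hs : 0 < s) (r : ℂ) (hr : 0 < r.re) :
    IntegrableOn (fun x : ℝ => ((x ^ (s - 1) : ℝ) : ℂ) * Complex.exp (-(r * x))) (Set.Ioi 0) := by
  have h := integrableOn_rpow_mul_exp_neg_mul_rpow (p := 1) (s := s - 1) (b := r.re) (by linarith) one_pos hr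
  refine Integrable.mono' h ?_ ?_
  · refine AEStronglyMeasurable.mul ?_ (by fun_prop)
    exact (Complex.measurable_ofReal.comp (by fun_prop)).aestronglyMeasurable
  · refine (ae_restrict_iff' measurableSet_Ioi).mpr (ae_of_all _ fun x hx => ?_)
    have hx : 0 < x := hx
    rw [norm_mul, Complex.norm_exp, Complex.norm_real, Real.norm_of_nonneg (by positivity)]
    simp

lemma cm_formula (s : ℝ) (hs : 0 < s) (r : ℂ) (hr : 0 < r.re) :
    ∫ x in Set.Ioi (0:ℝ), ((x ^ (s - 1) : ℝ) : ℂ) * Complex.exp (-(r * x)) =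
      (1 / r) ^ (s : ℂ) * (Real.Gamma s : ℂ) := by
  set U : Set ℂ := {z | 0 < z.re} with hU
  have hUo : IsOpen U := isOpen_lt continuous_const Complex.continuous_re
  have hUc : IsPreconnected U := (convex_halfSpace_re_gt 0).isPreconnected
  let H : ℂ → ℂ := fun r => ∫ x in Set.Ioi (0:ℝ), ((x ^ (s - 1) : ℝ) : ℂ) * Complex.exp (-(r * x))
  let R : ℂ → ℂ := fun r => (1 / r) ^ (s : ℂ) * (Real.Gamma s : ℂ)
  have hne : ∀ z ∈ U, z ≠ 0 := by
    intro z hz h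
    simp [hU, h] at hz
  have hH : DifferentiableOn ℂ H U := by
    intro r hr
    have hr : 0 < r.re := hr
    refine DifferentiableAt.differentiableWithinAt ?_
    have hb := integrableOn_rpow_mul_exp_neg_mul_rpow (p := 1) (s := s) (b := r.re / 2) (by linarith) one_pos
      (by linarith)
    have hn : {z : ℂ | r.re / 2 < z.re} ∈ 𝓝 r :=
      (isOpen_lt continuous_const Complex.continuous_re).mem_nhds (by simp; linarith)
    have := hasDerivAt_integral_of_dominated_loc_of_deriv_le (μ := volume.restrict (Set.Ioi (0:ℝ)))
      (F := fun r x => ((x ^ (s - 1) : ℝ) : ℂ) * Complex.exp (-(r * x)))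
      (F' := fun r x => ((x ^ (s - 1) : ℝ) : ℂ) * (Complex.exp (-(r * x)) * -x))
      (x₀ := r) (bound := fun x => x ^ s * Real.exp (-(r.re / 2) * x ^ (1:ℝ))) hn ?_ (cm_integrable s hs r hr) ?_ ?_ hb ?_
    · exact this.2.differentiableAt
    · filter_upwards [hn] with z hz
      exact (cm_integrable s hs z (lt_trans (half_pos hr) hz)).aestronglyMeasurable
    · refine AEStronglyMeasurable.mul ?_ (by fun_prop)
      exact (Complex.measurable_ofReal.comp (by fun_prop)).aestronglyMeasurable
    · refine (ae_restrict_iff' measurableSet_Ioi).mpr (ae_of_all _ fun x hx z hz => ?_)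
      have hx : 0 < x := hx
      have hz : r.re / 2 < z.re := hz
      rw [norm_mul, norm_mul, Complex.norm_exp, Complex.norm_real, Real.norm_of_nonneg (by positivity), norm_neg,
        Complex.norm_real, Real.norm_of_nonneg hx.le]
      have e : x ^ s = x ^ (s - 1) * x := by
        rw [← Real.rpow_add_one hx.ne']; congr 1; ring
      rw [e, Real.rpow_one]
      have : Real.exp ((-(z * x) : ℂ).re) ≤ Real.exp (-(r.re / 2) * x) := by
        apply Real.exp_le_exp.mpr
        simp
        nlinarith
      calc x ^ (s - 1) * (Real.exp ((-(z * x) : ℂ).re) * x) ≤ x ^ (s - 1) * (Real.exp (-(r.re / 2) * x) * x) := by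
            gcongr
        _ = _ := by ring
    · refine ae_of_all _ fun x z hz => ?_
      refine HasDerivAt.const_mul _ ?_
      have := (((hasDerivAt_id z).mul_const (x : ℂ)).neg).cexp
      refine this.congr_deriv ?_
      simp
  have hR : DifferentiableOn ℂ R U := by
    intro r hr
    refine DifferentiableAt.differentiableWithinAt ?_
    have h0 := hne r hr
    have hr : 0 < r.re := hr
    refine DifferentiableAt.mul_const ?_ _
    refine DifferentiableAt.cpow_const ((differentiableAt_const _).div differentiableAt_id h0) ?_
    left
    simp only [one_div, Complex.inv_re]
    exact div_pos hr (Complex.normSq_pos.mpr h0)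
  have heq : Set.EqOn H R U := by
    refine (hH.analyticOnNhd hUo).eqOn_of_preconnected_of_frequently_eq (hR.analyticOnNhd hUo) hUc
      (z₀ := 1) (by simp [hU]) ?_
    have hreal : ∀ t : ℝ, 0 < t → H t = R t := by
      intro t ht
      have h1 := Real.integral_rpow_mul_exp_neg_mul_Ioi hs ht
      have h2 : H t = ((∫ x in Set.Ioi (0:ℝ), x ^ (s - 1) * Real.exp (-(t * x)) : ℝ) : ℂ) := by
        rw [← integral_complex_ofReal]
        simp [H]
      rw [h2, h1]
      simp only [R]
      rw [Complex.ofReal_mul, Complex.ofReal_cpow (by positivity)]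
      push_cast
      rfl
    have htend : Tendsto (fun t : ℝ => (t : ℂ)) (𝓝[≠] (1:ℝ)) (𝓝[≠] (1:ℂ)) := by
      refine tendsto_nhdsWithin_of_tendsto_nhds_of_eventually_within _ ?_ ?_
      · have : Tendsto (fun t : ℝ => (t : ℂ)) (𝓝 (1:ℝ)) (𝓝 ((1:ℝ):ℂ)) := Complex.continuous_ofReal.tendsto 1
        simpa using this.mono_left nhdsWithin_le_nhds
      · filter_upwards [self_mem_nhdsWithin] with t ht
        simpa using ht
    refine htend.frequently (Eventually.frequently ?_)
    filter_upwards [mem_nhdsWithin_of_mem_nhds (Ioi_mem_nhds (show (0 : ℝ) < 1 by norm_num))] with t ht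
    exact hreal t ht
  exact heq hr

noncomputable def wrt (β : ℝ) (k : ℕ) : ℝ := (Real.Gamma (β + k / 2))⁻¹

noncomputable def wr (β x : ℝ) : ℝ := ∑' k : ℕ, (-x) ^ k / k.factorial * wrt β k

lemma wrt_eq (β : ℝ) (k : ℕ) : ((π * wrt β k : ℝ) : ℂ) = hkK (1 - 2 * β - k) := by
  rw [hkK_eq, wrt]
  congr 4
  ring

lemma wrt_bound (β : ℝ) (hβ : 1 / 2 ≤ β) : ∃ C : ℝ, ∀ k, |wrt β k| ≤ C := by
  refine ⟨π⁻¹ * ∫ u : ℝ, Real.exp (1 - u ^ 2), fun k => ?_⟩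
  have h1 : ‖hkK (1 - 2 * β - k)‖ ≤ ∫ u : ℝ, Real.exp (1 - u ^ 2) := by
    refine norm_integral_le_of_norm_le gauss_integrable (ae_of_all _ fun u => hk_norm_le u _ ?_)
    have : (0:ℝ) ≤ k := k.cast_nonneg
    linarith
  rw [← wrt_eq, Complex.norm_real, Real.norm_eq_abs, abs_mul, abs_of_pos Real.pi_pos] at h1
  rw [inv_mul_eq_div, le_div_iff₀ Real.pi_pos]
  linarith

lemma wr_summable_abs (β x : ℝ) (hβ : 1 / 2 ≤ β) :
    Summable (fun k : ℕ => |x| ^ k / k.factorial * |wrt β k|) := by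
  obtain ⟨C, hC⟩ := wrt_bound β hβ
  refine Summable.of_nonneg_of_le (fun k => by positivity) (fun k => ?_)
    ((Real.summable_pow_div_factorial |x|).mul_right C)
  gcongr
  exact hC k

lemma wr_eq (β x : ℝ) (hβ : 1 / 2 ≤ β) :
    ((π * wr β x : ℝ) : ℂ) = ∫ u : ℝ, hkE u * hkW u ^ ((1 - 2 * β : ℝ) : ℂ) * Complex.exp (-((hkW u)⁻¹ * x)) := by
  have h := hasSum_integral_of_summable_integral_norm (μ := (volume : Measure ℝ))
    (F := fun (k : ℕ) (u : ℝ) => ((-x : ℂ) ^ k / k.factorial) * (hkE u * hkW u ^ ((1 - 2 * β - k : ℝ) : ℂ)))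
    (fun k => (hk_integrable _).const_mul _) ?_
  · have e1 : ∀ k : ℕ, ∫ u : ℝ, ((-x : ℂ) ^ k / k.factorial) * (hkE u * hkW u ^ ((1 - 2 * β - k : ℝ) : ℂ)) =
        ((π * ((-x) ^ k / k.factorial * wrt β k) : ℝ) : ℂ) := by
      intro k
      rw [integral_const_mul]
      have := wrt_eq β k
      rw [hkK] at this
      rw [← this]
      push_cast
      ring
    simp_rw [e1] at h
    have e2 := h.tsum_eq
    rw [← Complex.ofReal_tsum, tsum_mul_left] at e2
    rw [wr, e2]
    refine integral_congr_ae (ae_of_all _ fun u => ?_)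
    have hx := NormedSpace.expSeries_div_hasSum_exp (-((hkW u)⁻¹ * x) : ℂ)
    rw [← Complex.exp_eq_exp_ℂ] at hx
    have hx2 := hx.mul_left (hkE u * hkW u ^ ((1 - 2 * β : ℝ) : ℂ))
    dsimp only
    rw [← hx2.tsum_eq]
    refine tsum_congr fun k => ?_
    have e3 : hkW u ^ ((1 - 2 * β - k : ℝ) : ℂ) = hkW u ^ ((1 - 2 * β : ℝ) : ℂ) * ((hkW u)⁻¹) ^ k := by
      rw [Complex.ofReal_sub, Complex.cpow_sub _ _ (hkW_ne u), Complex.ofReal_natCast, Complex.cpow_natCast, inv_pow]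
      rfl
    rw [e3, show (-((hkW u)⁻¹ * x) : ℂ) = (hkW u)⁻¹ * (-x) by ring, mul_pow]
    ring
  · refine Summable.of_nonneg_of_le (fun k => integral_nonneg fun u => norm_nonneg _) (fun k => ?_)
      ((Real.summable_pow_div_factorial |x|).mul_right (∫ u : ℝ, Real.exp (1 - u ^ 2)))
    rw [← integral_const_mul]
    refine integral_mono ((hk_integrable _).const_mul _).norm (gauss_integrable.const_mul _) fun u => ?_
    dsimp only
    rw [norm_mul]
    have : ‖((-x : ℂ) ^ k / k.factorial)‖ = |x| ^ k / k.factorial := by simp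
    rw [this]
    gcongr
    refine hk_norm_le u _ ?_
    have : (0:ℝ) ≤ k := k.cast_nonneg
    linarith

lemma wr_mellin (β s : ℝ) (hβ : 1 / 2 ≤ β) (hs : 0 < s) :
    IntegrableOn (fun x => x ^ (s - 1) * wr β x) (Set.Ioi 0) ∧
    ∫ x in Set.Ioi (0:ℝ), x ^ (s - 1) * wr β x = Real.Gamma s * (Real.Gamma (β - s / 2))⁻¹ := by
  let μ := volume.restrict (Set.Ioi (0:ℝ))
  let Φ : ℝ → ℝ → ℂ := fun x u => (hkE u * hkW u ^ ((1 - 2 * β : ℝ) : ℂ)) *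
    (((x ^ (s - 1) : ℝ) : ℂ) * Complex.exp (-((hkW u)⁻¹ * x)))
  have hre : ∀ u, (hkW u)⁻¹.re = (1 + u ^ 2)⁻¹ := by
    intro u
    rw [Complex.inv_re, hkW_re, ← Complex.sq_norm, hkW_norm_sq, one_div]
  have hrepos : ∀ u, 0 < (hkW u)⁻¹.re := by
    intro u; rw [hre]; positivity
  have hcinv : Continuous fun u => (hkW u)⁻¹ := hkW_cont.inv₀ hkW_ne
  have hmeas : AEStronglyMeasurable (Function.uncurry Φ) (μ.prod volume) := by
    apply Measurable.aestronglyMeasurable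
    have c1 : Measurable fun z : ℝ × ℝ => hkE z.2 * hkW z.2 ^ ((1 - 2 * β : ℝ) : ℂ) :=
      (hkE_cont.mul (hkWp_cont _)).measurable.comp measurable_snd
    have c2 : Measurable fun z : ℝ × ℝ => ((z.1 ^ (s - 1) : ℝ) : ℂ) :=
      Complex.measurable_ofReal.comp (by fun_prop)
    have c3 : Measurable fun z : ℝ × ℝ => Complex.exp (-((hkW z.2)⁻¹ * z.1)) := by
      apply Continuous.measurable
      have := hcinv.comp (continuous_snd (X := ℝ) (Y := ℝ))
      simp only [Function.comp_def] at this
      fun_prop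
    exact c1.mul (c2.mul c3)
  have hprodInt : Integrable (Function.uncurry Φ) (μ.prod volume) := by
    rw [integrable_prod_iff' hmeas]
    refine ⟨ae_of_all _ fun u => ?_, ?_⟩
    · exact Integrable.const_mul (cm_integrable s hs _ (hrepos u)) (hkE u * hkW u ^ ((1 - 2 * β : ℝ) : ℂ))
    · have hb := (gauss_pow_integrable ((1 - 2 * β) / 2 + s)).mul_const (Real.Gamma s)
      refine hb.congr (ae_of_all _ fun u => ?_)
      simp only [Function.uncurry, Φ, norm_mul _ (_ * _)]
      rw [integral_const_mul, hk_norm]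
      have : ∫ x in Set.Ioi (0:ℝ), ‖((x ^ (s - 1) : ℝ) : ℂ) * Complex.exp (-((hkW u)⁻¹ * x))‖ =
          (1 + u ^ 2) ^ s * Real.Gamma s := by
        have h1 := Real.integral_rpow_mul_exp_neg_mul_Ioi hs (hrepos u)
        rw [hre] at h1
        rw [one_div, inv_inv] at h1
        rw [← h1]
        refine setIntegral_congr_fun measurableSet_Ioi fun x hx => ?_
        have hx : 0 < x := hx
        rw [norm_mul, Complex.norm_exp, Complex.norm_real, Real.norm_of_nonneg (by positivity), Complex.neg_re,
          Complex.re_mul_ofReal, hre]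
      rw [this, Real.rpow_add (by positivity)]
      ring
  have hin : ∀ x, ∫ u, Φ x u = ((π * (x ^ (s - 1) * wr β x) : ℝ) : ℂ) := by
    intro x
    have : ∀ u, Φ x u = ((x ^ (s - 1) : ℝ) : ℂ) *
        (hkE u * hkW u ^ ((1 - 2 * β : ℝ) : ℂ) * Complex.exp (-((hkW u)⁻¹ * x))) := by
      intro u; simp only [Φ]; ring
    simp_rw [this]
    rw [integral_const_mul, ← wr_eq β x hβ]
    push_cast; ring
  have hswap := integral_integral_swap hprodInt
  simp_rw [hin] at hswap
  have hI := hprodInt.integral_prod_left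
  simp only [Function.uncurry] at hI
  simp_rw [hin] at hI
  have hI2 := hI.re
  simp only [RCLike.re_to_complex, Complex.ofReal_re] at hI2
  constructor
  · have := hI2.const_mul π⁻¹
    refine this.congr (ae_of_all _ fun x => ?_)
    have := Real.pi_ne_zero
    field_simp
  · have hr : ∀ u, ∫ x, Φ x u ∂μ = (Real.Gamma s : ℂ) * (hkE u * hkW u ^ ((1 - 2 * β + s : ℝ) : ℂ)) := by
      intro u
      simp only [Φ, μ]
      rw [integral_const_mul, cm_formula s hs _ (hrepos u), one_div, inv_inv, Complex.ofReal_add (1 - 2 * β) s,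
        Complex.cpow_add _ _ (hkW_ne u)]
      ring
    simp_rw [hr] at hswap
    rw [integral_const_mul, integral_complex_ofReal, integral_const_mul] at hswap
    have hk := hkK_eq (1 - 2 * β + s)
    rw [hkK] at hk
    rw [hk, ← Complex.ofReal_mul] at hswap
    have h3 := Complex.ofReal_injective hswap
    have h4 : (1 - (1 - 2 * β + s)) / 2 = β - s / 2 := by ring
    rw [h4] at h3
    have := Real.pi_ne_zero
    apply mul_left_cancel₀ this
    rw [h3]; ring

lemma fmn_coeff (n k : ℕ) (hn : 1 ≤ n) (η : ℝ) (hη : 0 < η) :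
    η ^ ((n : ℝ) / 2) * (η / 2) ^ ((2 * k : ℝ) + ((n : ℝ) - 2) / 2) /
      (k.factorial * Real.Gamma ((k : ℝ) + ((n : ℝ) - 2) / 2 + 1)) *
      (1 / 4 * Real.Gamma ((2 * k + n - 1 + 1) / 4)) =
    η ^ ((n : ℝ) - 1) * (2 ^ (-(n : ℝ)) * √π) * ((η ^ 2 / 8) ^ k / k.factorial * wrt ((n : ℝ) / 4 + 1 / 2) k) := by
  have hn' : (1 : ℝ) ≤ n := by exact_mod_cast hn
  have hk : (0 : ℝ) ≤ k := k.cast_nonneg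
  set z : ℝ := (2 * k + n) / 4 with hz
  have hzpos : 0 < z := by positivity
  have hd := Real.Gamma_mul_Gamma_add_half z
  have g1 : (k : ℝ) + ((n : ℝ) - 2) / 2 + 1 = 2 * z := by rw [hz]; ring
  have g2 : ((2 * k + n - 1 + 1) / 4 : ℝ) = z := by rw [hz]; ring
  have g3 : (n : ℝ) / 4 + 1 / 2 + k / 2 = z + 1 / 2 := by rw [hz]; ring
  rw [wrt, g1, g2, g3]
  have p1 : 0 < Real.Gamma (z + 1 / 2) := Real.Gamma_pos_of_pos (by linarith)
  have p2 : 0 < Real.Gamma (2 * z) := Real.Gamma_pos_of_pos (by linarith)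
  have hG : Real.Gamma z = Real.Gamma (2 * z) * 2 ^ (1 - 2 * z) * √π * (Real.Gamma (z + 1 / 2))⁻¹ := by
    rw [← hd]; field_simp
  rw [hG]
  have hpow : η ^ ((n : ℝ) / 2) * (η / 2) ^ ((2 * k : ℝ) + ((n : ℝ) - 2) / 2) * 2 ^ (1 - 2 * z) * (1 / 4) =
      η ^ ((n : ℝ) - 1) * 2 ^ (-(n : ℝ)) * (η ^ 2 / 8) ^ k := by
    have q1 : (η ^ 2 / 8) ^ k = η ^ (2 * k : ℝ) * 2 ^ (-(3 * k) : ℝ) := by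
      have q3 : (2:ℝ) ^ (3 * k : ℝ) = 8 ^ k := by
        rw [Real.rpow_mul (by norm_num), Real.rpow_natCast]; norm_num
      have q4 : η ^ (2 * k : ℝ) = (η ^ 2) ^ k := by
        rw [Real.rpow_mul hη.le, Real.rpow_natCast, Real.rpow_two]
      rw [Real.rpow_neg (by norm_num), q3, q4, div_pow, div_eq_mul_inv]
    have q2 : (1 / 4 : ℝ) = 2 ^ (-2 : ℝ) := by
      rw [Real.rpow_neg (by norm_num)]; norm_num
    rw [q1, q2, Real.div_rpow hη.le (by norm_num), div_eq_mul_inv (η ^ _) (2 ^ _), ← Real.rpow_neg (by norm_num : (0:ℝ) ≤ 2)]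
    calc _ = (η ^ ((n : ℝ) / 2) * η ^ ((2 * k : ℝ) + ((n : ℝ) - 2) / 2)) *
          (2 ^ (-((2 * k : ℝ) + ((n : ℝ) - 2) / 2)) * 2 ^ (1 - 2 * z) * 2 ^ (-2 : ℝ)) := by ring
      _ = (η ^ ((n : ℝ) - 1) * η ^ (2 * k : ℝ)) * (2 ^ (-(n : ℝ)) * 2 ^ (-(3 * k) : ℝ)) := by
        rw [← Real.rpow_add hη, ← Real.rpow_add hη, ← Real.rpow_add two_pos, ← Real.rpow_add two_pos,
          ← Real.rpow_add two_pos]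
        congr 2
        · ring
        · rw [hz]; ring
      _ = _ := by ring
  have hf : (k.factorial : ℝ) ≠ 0 := by positivity
  calc _ = (η ^ ((n : ℝ) / 2) * (η / 2) ^ ((2 * k : ℝ) + ((n : ℝ) - 2) / 2) * 2 ^ (1 - 2 * z) * (1 / 4)) *
        (√π / k.factorial * (Real.Gamma (z + 1 / 2))⁻¹) := by
        field_simp
    _ = _ := by rw [hpow]; ring

lemma fmn_eq (n : ℕ) (hn : 1 ≤ n) (η : ℝ) (hη : 0 < η) :
    fmn 2 n η = 2 ^ (-(n : ℝ)) * √π * wr ((n : ℝ) / 4 + 1 / 2) (η ^ 2 / 8) := by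
  have hn' : (1 : ℝ) ≤ n := by exact_mod_cast hn
  let A : ℕ → ℝ := fun k => η ^ ((n : ℝ) / 2) * (η / 2) ^ ((2 * k : ℝ) + ((n : ℝ) - 2) / 2) /
      (k.factorial * Real.Gamma ((k : ℝ) + ((n : ℝ) - 2) / 2 + 1))
  have hApos : ∀ k, 0 < A k := by
    intro k
    have hk : (0 : ℝ) ≤ k := k.cast_nonneg
    have : 0 < Real.Gamma ((k : ℝ) + ((n : ℝ) - 2) / 2 + 1) := Real.Gamma_pos_of_pos (by linarith)
    simp only [A]
    positivity
  let F : ℕ → ℝ → ℝ := fun k s => Real.exp (-(s ^ (2 * 2))) * (η * s) ^ ((n : ℝ) / 2) *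
    ((-1 : ℝ) ^ k * (η * s / 2) ^ ((2 * k : ℝ) + ((n : ℝ) - 2) / 2) /
    (Nat.factorial k * Real.Gamma ((k : ℝ) + ((n : ℝ) - 2) / 2 + 1)))
  have hF : ∀ k, ∀ s ∈ Set.Ioi (0:ℝ), F k s =
      ((-1) ^ k * A k) * (s ^ (2 * k + n - 1 : ℝ) * Real.exp (-s ^ (4:ℝ))) := by
    intro k s hs
    have hs : 0 < s := hs
    have e1 : s ^ (4:ℝ) = s ^ (2 * 2) := by
      rw [← Real.rpow_natCast]; norm_num
    have e2 : s ^ (2 * k + n - 1 : ℝ) = s ^ ((n : ℝ) / 2) * s ^ ((2 * k : ℝ) + ((n : ℝ) - 2) / 2) := by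
      rw [← Real.rpow_add hs]; congr 1; ring
    have e3 : η * s / 2 = (η / 2) * s := by ring
    simp only [F, A]
    rw [e1, e2, e3, Real.mul_rpow hη.le hs.le, Real.mul_rpow (by positivity) hs.le]
    ring
  have hq : ∀ k : ℕ, (-1 : ℝ) < 2 * k + n - 1 := by
    intro k
    have hk : (0 : ℝ) ≤ k := k.cast_nonneg
    linarith
  have hbase : ∀ k : ℕ, IntegrableOn (fun s : ℝ => s ^ (2 * k + n - 1 : ℝ) * Real.exp (-s ^ (4:ℝ))) (Set.Ioi 0) :=
    fun k => integrableOn_rpow_mul_exp_neg_rpow (hq k) (by norm_num)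
  have hval : ∀ k : ℕ, ∫ s in Set.Ioi (0:ℝ), s ^ (2 * k + n - 1 : ℝ) * Real.exp (-s ^ (4:ℝ)) =
      1 / 4 * Real.Gamma ((2 * k + n - 1 + 1) / 4) :=
    fun k => integral_rpow_mul_exp_neg_rpow (by norm_num) (hq k)
  have hcoef : ∀ k : ℕ, A k * (1 / 4 * Real.Gamma ((2 * k + n - 1 + 1) / 4)) =
      η ^ ((n : ℝ) - 1) * (2 ^ (-(n : ℝ)) * √π) * ((η ^ 2 / 8) ^ k / k.factorial * wrt ((n : ℝ) / 4 + 1 / 2) k) :=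
    fun k => fmn_coeff n k hn η hη
  have hwpos : ∀ k, 0 ≤ wrt ((n : ℝ) / 4 + 1 / 2) k := by
    intro k
    exact inv_nonneg.mpr (Real.Gamma_pos_of_pos (by positivity)).le
  have hFint : ∀ k, Integrable (F k) (volume.restrict (Set.Ioi 0)) := by
    intro k
    have : IntegrableOn (fun s => ((-1) ^ k * A k) * (s ^ (2 * k + n - 1 : ℝ) * Real.exp (-s ^ (4:ℝ)))) (Set.Ioi 0) :=
      Integrable.const_mul (hbase k) _
    exact (integrableOn_congr_fun (hF k) measurableSet_Ioi).mpr this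
  have h := hasSum_integral_of_summable_integral_norm hFint ?_
  · have e1 : ∀ k, ∫ s in Set.Ioi (0:ℝ), F k s =
        η ^ ((n : ℝ) - 1) * (2 ^ (-(n : ℝ)) * √π) *
          ((-(η ^ 2 / 8)) ^ k / k.factorial * wrt ((n : ℝ) / 4 + 1 / 2) k) := by
      intro k
      rw [setIntegral_congr_fun measurableSet_Ioi (hF k), integral_const_mul, hval, mul_assoc, hcoef, neg_pow (η ^ 2 / 8)]
      ring
    simp_rw [e1] at h
    have e2 := h.tsum_eq
    rw [tsum_mul_left] at e2
    have e3 : ∀ s, ∑' k, F k s = Real.exp (-(s ^ (2 * 2))) * (η * s) ^ ((n : ℝ) / 2) *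
        besselJ (((n : ℝ) - 2) / 2) (η * s) := by
      intro s
      simp only [F]
      rw [tsum_mul_left, besselJ]
    simp_rw [e3] at e2
    rw [fmn, ← e2, wr]
    have e4 : η ^ ((1:ℝ) - n) * η ^ ((n : ℝ) - 1) = 1 := by
      rw [← Real.rpow_add hη]; simp
    calc _ = (η ^ ((1:ℝ) - n) * η ^ ((n : ℝ) - 1)) * (2 ^ (-(n : ℝ)) * √π *
          ∑' k : ℕ, (-(η ^ 2 / 8)) ^ k / k.factorial * wrt ((n : ℝ) / 4 + 1 / 2) k) := by
          simp only [mul_assoc]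
      _ = _ := by rw [e4, one_mul]
  · have hs := (wr_summable_abs ((n : ℝ) / 4 + 1 / 2) (η ^ 2 / 8) (by linarith)).mul_left
      (η ^ ((n : ℝ) - 1) * (2 ^ (-(n : ℝ)) * √π))
    refine hs.congr fun k => ?_
    have : ∫ s in Set.Ioi (0:ℝ), ‖F k s‖ = ∫ s in Set.Ioi (0:ℝ), A k * (s ^ (2 * k + n - 1 : ℝ) * Real.exp (-s ^ (4:ℝ))) := by
      refine setIntegral_congr_fun measurableSet_Ioi fun s hs => ?_
      have hs' : 0 < s := hs
      simp only [hF k s hs]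
      rw [norm_mul, norm_mul, norm_pow, norm_neg, norm_one, one_pow, one_mul, Real.norm_of_nonneg (hApos k).le,
        Real.norm_of_nonneg (by positivity)]
    rw [this, integral_const_mul, hval, hcoef, abs_of_nonneg (hwpos k), abs_of_nonneg (by positivity)]

lemma gamma_inv_pos (x : ℝ) (hx : 0 < x) : 0 < (Real.Gamma x)⁻¹ := inv_pos.mpr (Real.Gamma_pos_of_pos hx)

lemma gamma_inv_sign (m : ℕ) : ∀ x : ℝ, -(m : ℝ) < x → x < -(m : ℝ) + 1 → 0 < (-1) ^ m * (Real.Gamma x)⁻¹ := by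
  induction m with
  | zero => intro x h1 h2; simpa using Real.Gamma_pos_of_pos (by simpa using h1)
  | succ m ih =>
    intro x h1 h2
    push_cast at h1 h2
    have hm : (0:ℝ) ≤ m := m.cast_nonneg
    have hx : x < 0 := by linarith
    have h := ih (x + 1) (by linarith) (by linarith)
    rw [Real.Gamma_add_one hx.ne, mul_inv] at h
    have h3 : (-1) ^ (m + 1) * (Real.Gamma x)⁻¹ = (-x) * ((-1) ^ m * (x⁻¹ * (Real.Gamma x)⁻¹)) := by
      have := hx.ne
      rw [pow_succ]
      field_simp
    rw [h3]
    exact mul_pos (by linarith) h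

lemma radial_mellin (β q : ℝ) (hβ : 1 / 2 ≤ β) (hq : 0 < q) :
    IntegrableOn (fun r => r ^ (q - 1) * wr β (r ^ 2 / 4)) (Set.Ioi 0) ∧
    ∃ C : ℝ, 0 < C ∧ ∫ r in Set.Ioi (0:ℝ), r ^ (q - 1) * wr β (r ^ 2 / 4) = C * (Real.Gamma (β - q / 4))⁻¹ := by
  obtain ⟨hI, hV⟩ := wr_mellin β (q / 2) hβ (by linarith)
  let h : ℝ → ℝ := fun x => x ^ (q / 2 - 1) * wr β x
  have hcomp : ∀ r ∈ Set.Ioi (0:ℝ), r ^ (q - 1) * wr β (r ^ 2 / 4) =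
      (2⁻¹ * (4:ℝ) ^ (q / 2 - 1)) * ((2 * r ^ ((2:ℝ) - 1)) • h (1 / 4 * r ^ (2:ℝ))) := by
    intro r hr
    have hr : 0 < r := hr
    have e1 : r ^ (q - 1) = r * (r ^ 2) ^ (q / 2 - 1) := by
      rw [← Real.rpow_natCast, ← Real.rpow_mul hr.le]
      nth_rw 2 [← Real.rpow_one r]
      rw [← Real.rpow_add hr]; congr 1; push_cast; ring
    have e2 : (1 / 4 * r ^ 2) ^ (q / 2 - 1) * (4:ℝ) ^ (q / 2 - 1) = (r ^ 2) ^ (q / 2 - 1) := by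
      rw [← Real.mul_rpow (by positivity) (by positivity)]; congr 1; ring
    have e3 : r ^ ((2:ℝ) - 1) = r := by norm_num
    simp only [h, smul_eq_mul]
    rw [e3, Real.rpow_two, e1, ← e2, show r ^ 2 / 4 = 1 / 4 * r ^ 2 by ring]
    ring
  constructor
  · rw [integrableOn_congr_fun hcomp measurableSet_Ioi]
    refine Integrable.const_mul ?_ _
    have h1 : IntegrableOn (fun y => h (1 / 4 * y)) (Set.Ioi 0) := by
      rw [integrableOn_Ioi_comp_mul_left_iff h 0 (by norm_num : (0:ℝ) < 1 / 4), mul_zero]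
      exact hI
    have h2 := (integrableOn_Ioi_comp_rpow_iff (fun y => h (1 / 4 * y)) (p := (2:ℝ)) (by norm_num)).mpr h1
    rw [abs_of_pos (two_pos : (0:ℝ) < 2)] at h2
    exact h2
  · refine ⟨(2⁻¹ * (4:ℝ) ^ (q / 2 - 1)) * (4 * Real.Gamma (q / 2)), ?_, ?_⟩
    · have := Real.Gamma_pos_of_pos (show 0 < q / 2 by linarith)
      positivity
    · rw [setIntegral_congr_fun measurableSet_Ioi hcomp, integral_const_mul,
        integral_comp_rpow_Ioi_of_pos (g := fun y => h (1 / 4 * y)) (p := 2) (by norm_num),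
        integral_comp_mul_left_Ioi h 0 (by norm_num : (0:ℝ) < 1 / 4), mul_zero, hV,
        show q / 2 / 2 = q / 4 by ring, smul_eq_mul]
      ring

/-- signs of the radial moments `M_b = ∫ |y|^b v_∞(y) dy`, `b > -n`. -/
theorem vinf_radial_moments_signs (n : ℕ) (hn : 1 ≤ n)
    (α : ℝ) (hα : 0 < α)
    (hαdef : α⁻¹ = ∫ x : EuclideanSpace ℝ (Fin n), fmn 2 n ‖x‖)
    (b : ℝ) (hb : -(n : ℝ) < b) :
    Integrable (fun y : EuclideanSpace ℝ (Fin n) => ‖y‖ ^ b * vinf n α y) ∧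
    (((-(n : ℝ) < b ∧ b < 2) ∨ ∃ k : ℕ, 8 * (k : ℝ) + 6 < b ∧ b < 8 * (k : ℝ) + 10) →
      0 < ∫ y : EuclideanSpace ℝ (Fin n), ‖y‖ ^ b * vinf n α y) ∧
    ((∃ j : ℕ, b = 4 * (j : ℝ) + 2) →
      (∫ y : EuclideanSpace ℝ (Fin n), ‖y‖ ^ b * vinf n α y) = 0) ∧
    ((∃ k : ℕ, 8 * (k : ℝ) + 2 < b ∧ b < 8 * (k : ℝ) + 6) →
      (∫ y : EuclideanSpace ℝ (Fin n), ‖y‖ ^ b * vinf n α y) < 0) := by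
  have hn' : (1 : ℝ) ≤ n := by exact_mod_cast hn
  obtain ⟨hI, C, hC, hV⟩ := radial_mellin ((n : ℝ) / 4 + 1 / 2) (n + b) (by linarith) (by linarith)
  let D : ℝ := 2 ^ ((n : ℝ) / 2) * α * (2 ^ (-(n : ℝ)) * √π)
  have hD : 0 < D := by positivity
  let f : ℝ → ℝ := fun r => r ^ b * (2 ^ ((n : ℝ) / 2) * α * fmn 2 n (Real.sqrt 2 * r))
  have : Nonempty (Fin n) := ⟨⟨0, hn⟩⟩
  have : Nontrivial (EuclideanSpace ℝ (Fin n)) := by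
    apply Module.nontrivial_of_finrank_pos (R := ℝ)
    rw [finrank_euclideanSpace_fin]
    exact hn
  have hfr : ∀ r ∈ Set.Ioi (0:ℝ), r ^ (n - 1) • f r =
      D * (r ^ ((n : ℝ) + b - 1) * wr ((n : ℝ) / 4 + 1 / 2) (r ^ 2 / 4)) := by
    intro r hr
    have hr : 0 < r := hr
    have e1 : r ^ ((n : ℝ) + b - 1) = r ^ (n - 1) * r ^ b := by
      rw [← Real.rpow_natCast, ← Real.rpow_add hr]
      congr 1
      rw [Nat.cast_sub hn]
      push_cast; ring
    have e2 : (Real.sqrt 2 * r) ^ 2 / 8 = r ^ 2 / 4 := by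
      rw [mul_pow, Real.sq_sqrt (by norm_num)]; ring
    simp only [f, D, smul_eq_mul]
    rw [fmn_eq n hn _ (by positivity), e1, e2]
    ring
  have hprodInt : Integrable (fun y : EuclideanSpace ℝ (Fin n) => ‖y‖ ^ b * vinf n α y) := by
    have := (integrable_fun_norm_addHaar (volume : Measure (EuclideanSpace ℝ (Fin n))) (f := f)).mpr ?_
    · exact this
    · rw [finrank_euclideanSpace_fin, integrableOn_congr_fun hfr measurableSet_Ioi]
      exact Integrable.const_mul hI D
  obtain ⟨M, hM, hval⟩ : ∃ M : ℝ, 0 < M ∧ (∫ y : EuclideanSpace ℝ (Fin n), ‖y‖ ^ b * vinf n α y) =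
      M * (Real.Gamma (1 / 2 - b / 4))⁻¹ := by
    have h := integral_fun_norm_addHaar (volume : Measure (EuclideanSpace ℝ (Fin n))) f
    rw [finrank_euclideanSpace_fin, setIntegral_congr_fun measurableSet_Ioi hfr, integral_const_mul, hV,
      nsmul_eq_mul, smul_eq_mul] at h
    refine ⟨n * ((volume : Measure (EuclideanSpace ℝ (Fin n))).real (Metric.ball 0 1) * (D * C)), ?_, ?_⟩
    · have hb : 0 < (volume : Measure (EuclideanSpace ℝ (Fin n))).real (Metric.ball 0 1) :=
        ENNReal.toReal_pos (Metric.measure_ball_pos volume 0 one_pos).ne' measure_ball_lt_top.ne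
      have hn0 : (0:ℝ) < n := by linarith
      positivity
    · have e : (n : ℝ) / 4 + 1 / 2 - (n + b) / 4 = 1 / 2 - b / 4 := by ring
      rw [e] at h
      refine Eq.trans h ?_
      ring
  refine ⟨hprodInt, ?_, ?_, ?_⟩
  · rw [hval]
    rintro (⟨-, h⟩ | ⟨k, h1, h2⟩)
    · exact mul_pos hM (gamma_inv_pos _ (by linarith))
    · have := gamma_inv_sign (2 * (k + 1)) (1 / 2 - b / 4) (by push_cast; linarith) (by push_cast; linarith)
      rw [pow_mul] at this
      norm_num at this
      exact mul_pos hM (inv_pos.mpr this)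
  · rw [hval]
    rintro ⟨j, rfl⟩
    have : (1 / 2 - (4 * (j : ℝ) + 2) / 4) = -(j : ℝ) := by ring
    rw [this, Real.Gamma_neg_nat_eq_zero]
    simp
  · rw [hval]
    rintro ⟨k, h1, h2⟩
    have := gamma_inv_sign (2 * k + 1) (1 / 2 - b / 4) (by push_cast; linarith) (by push_cast; linarith)
    rw [pow_succ, pow_mul] at this
    norm_num at this
    exact mul_neg_of_pos_of_neg hM (inv_lt_zero.mpr this)
end

section
/- Let n ≥ 1 and let u_0 : ℝ^n → ℝ be continuous and bounded with (1+|y|^4) u_0 ∈ L^1(ℝ^n) and ∫_{ℝ^n} u_0 = ∫_{ℝ^n} v_∞ = 1. Let u(x,t) = α_n ∫_{ℝ^n} f_n(|z|) u_0(x − t^{1/4} z) dz be the solution of the biharmonic heat equation u_t + Δ²u = 0 with datum u_0, and define v(y,τ) = e^{nτ} u(e^τ y, (e^{4τ}−1)/4) for τ > 0. Then lim_{τ→+∞} ∫_{ℝ^n} |y|^4 v(y,τ) dy = M_4, where M_4 = ∫_{ℝ^n} |y|^4 v_∞(y) dy, and M_4 < 0. -/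
open MeasureTheory Real Filter Topology

section helpers
open scoped SchwartzMap ContDiff FourierTransform LineDeriv


lemma tg_norm_four {E : Type*} [NormedAddCommGroup E] [InnerProductSpace ℝ E] :
    Function.HasTemperateGrowth (fun x : E => -(‖x‖ ^ 4)) := by
  have h := (Function.hasTemperateGrowth_norm_sq (H := E)).pow 2
  have h2 := h.neg
  have e : (fun x : E => -(‖x‖ ^ 4)) = -((fun x : E => ‖x‖ ^ 2) ^ 2) := by
    funext x
    simp [← pow_mul]
  rw [e]
  exact h2

lemma poly_exp_bdd (m : ℕ) : ∃ C : ℝ, ∀ r : ℝ, 0 ≤ r → (1 + r) ^ m * Real.exp (-(r ^ 4)) ≤ C := by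
  refine ⟨(m.factorial : ℝ) * Real.exp 3, fun r hr => ?_⟩
  have h1 : (1 + r) ^ m / m.factorial ≤ Real.exp (1 + r) :=
    Real.pow_div_factorial_le_exp (1 + r) (by linarith) m
  have h2 : (1 + r) ^ m ≤ m.factorial * Real.exp (1 + r) := by
    rw [div_le_iff₀ (by positivity)] at h1
    linarith
  calc (1 + r) ^ m * Real.exp (-(r ^ 4)) ≤ m.factorial * Real.exp (1 + r) * Real.exp (-(r ^ 4)) := by
        gcongr
    _ = m.factorial * Real.exp (1 + r - r ^ 4) := by
        rw [mul_assoc, ← Real.exp_add]; ring_nf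
    _ ≤ _ := by
        gcongr
        nlinarith [sq_nonneg (r ^ 2 - 1), sq_nonneg (r - 1)]

lemma exp_four_decay {E : Type*} [NormedAddCommGroup E] [InnerProductSpace ℝ E] (k l : ℕ) :
    ∃ C : ℝ, ∀ x : E, ‖x‖ ^ k *
      ‖iteratedFDeriv ℝ l (fun x : E => ((Real.exp (-(‖x‖ ^ 4)) : ℝ) : ℂ)) x‖ ≤ C := by
  obtain ⟨p, C, hC, hb⟩ := (tg_norm_four (E := E)).norm_iteratedFDeriv_le_uniform l
  obtain ⟨B, hB⟩ := poly_exp_bdd (k + p * l)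
  have hsm : ContDiff ℝ ∞ (fun x : E => -(‖x‖ ^ 4)) := (tg_norm_four (E := E)).1
  have hg : ContDiff ℝ ∞ (fun t : ℝ => ((Real.exp t : ℝ) : ℂ)) :=
    Complex.ofRealCLM.contDiff.comp Real.contDiff_exp
  have hgd : ∀ i : ℕ, ∀ t : ℝ,
      ‖iteratedFDeriv ℝ i (fun t : ℝ => ((Real.exp t : ℝ) : ℂ)) t‖ ≤ Real.exp t := by
    intro i t
    have := Complex.ofRealLI.norm_iteratedFDeriv_comp_left (f := Real.exp) (x := t) (i := i)
      (n := ∞) (Real.contDiff_exp.contDiffAt) (by exact_mod_cast le_top)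
    have e : (Complex.ofRealLI ∘ Real.exp) = (fun t : ℝ => ((Real.exp t : ℝ) : ℂ)) := rfl
    rw [e] at this
    rw [this, norm_iteratedFDeriv_eq_norm_iteratedDeriv, iteratedDeriv_eq_iterate,
      Real.iter_deriv_exp]
    simp
  refine ⟨l.factorial * (max C 1) ^ l * B, fun x => ?_⟩
  have key := norm_iteratedFDeriv_comp_le (g := fun t : ℝ => ((Real.exp t : ℝ) : ℂ))
    (f := fun x : E => -(‖x‖ ^ 4)) (n := l) (N := ∞) hg hsm
    (by exact_mod_cast le_top) x (C := Real.exp (-(‖x‖ ^ 4))) (D := max C 1 * (1 + ‖x‖) ^ p)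
    (fun i _ => hgd i _) (fun i hi1 hil => by
      refine (hb i hil x).trans ?_
      have h1 : 1 ≤ max C 1 * (1 + ‖x‖) ^ p := by
        have : 1 ≤ (1 + ‖x‖) ^ p := one_le_pow₀ (by linarith [norm_nonneg x])
        have := le_max_right C 1
        nlinarith
      calc C * (1 + ‖x‖) ^ p ≤ max C 1 * (1 + ‖x‖) ^ p := by
            gcongr; exact le_max_left _ _
        _ = (max C 1 * (1 + ‖x‖) ^ p) ^ 1 := (pow_one _).symm
        _ ≤ _ := pow_le_pow_right₀ h1 hi1)
  have e : ((fun t : ℝ => ((Real.exp t : ℝ) : ℂ)) ∘ (fun x : E => -(‖x‖ ^ 4)))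
    = (fun x : E => ((Real.exp (-(‖x‖ ^ 4)) : ℝ) : ℂ)) := rfl
  rw [e] at key
  calc _ ≤ (1 + ‖x‖) ^ k * (l.factorial * Real.exp (-(‖x‖ ^ 4)) * (max C 1 * (1 + ‖x‖) ^ p) ^ l) := by
        gcongr; linarith
    _ = l.factorial * (max C 1) ^ l * ((1 + ‖x‖) ^ (k + p * l) * Real.exp (-(‖x‖ ^ 4))) := by
        rw [mul_pow, ← pow_mul, pow_add]; ring
    _ ≤ _ := by
        gcongr
        exact hB _ (norm_nonneg x)

/-- the Schwartz function `exp(-|ξ|^4)` -/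
noncomputable def Gs (n : ℕ) : 𝓢(EuclideanSpace ℝ (Fin n), ℂ) where
  toFun x := ((Real.exp (-(‖x‖ ^ 4)) : ℝ) : ℂ)
  smooth' := (Complex.ofRealCLM.contDiff.comp Real.contDiff_exp).comp tg_norm_four.1
  decay' k l := exp_four_decay k l

lemma Gs_apply (n : ℕ) (x : EuclideanSpace ℝ (Fin n)) :
    Gs n x = ((Real.exp (-(‖x‖ ^ 4)) : ℝ) : ℂ) := rfl

/-- spherical moments -/
noncomputable def sphA (n k : ℕ) (x : EuclideanSpace ℝ (Fin n)) : ℝ :=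
  ∫ w : Metric.sphere (0 : EuclideanSpace ℝ (Fin n)) 1, (inner ℝ x (w : EuclideanSpace ℝ (Fin n))) ^ (2 * k)
    ∂((volume : Measure (EuclideanSpace ℝ (Fin n))).toSphere)

lemma moment_polar (n k : ℕ) (hn : 1 ≤ n) (x : EuclideanSpace ℝ (Fin n)) (g : ℝ → ℝ) :
    ∫ y : EuclideanSpace ℝ (Fin n), (inner ℝ x y) ^ (2 * k) * g ‖y‖ =
      sphA n k x * ∫ s in Set.Ioi (0 : ℝ), s ^ (n - 1 + 2 * k) * g s := by
  have : Nontrivial (EuclideanSpace ℝ (Fin n)) := by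
    have : Nonempty (Fin n) := ⟨⟨0, hn⟩⟩
    infer_instance
  set μ : Measure (EuclideanSpace ℝ (Fin n)) := volume
  calc ∫ y : EuclideanSpace ℝ (Fin n), (inner ℝ x y) ^ (2 * k) * g ‖y‖
      = ∫ y : ({(0)}ᶜ : Set (EuclideanSpace ℝ (Fin n))),
          (inner ℝ x y.1) ^ (2 * k) * g ‖y.1‖ ∂(μ.comap (↑)) := by
        rw [integral_subtype_comap (measurableSet_singleton _).compl
          fun y : EuclideanSpace ℝ (Fin n) ↦ (inner ℝ x y) ^ (2 * k) * g ‖y‖,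
          restrict_compl_singleton]
    _ = ∫ p : Metric.sphere (0 : EuclideanSpace ℝ (Fin n)) 1 × Set.Ioi (0 : ℝ),
          (inner ℝ x p.1.1) ^ (2 * k) * (p.2.1 ^ (2 * k) * g p.2.1)
          ∂μ.toSphere.prod (.volumeIoiPow (Module.finrank ℝ (EuclideanSpace ℝ (Fin n)) - 1)) := by
        rw [← μ.measurePreserving_homeomorphUnitSphereProd.integral_comp
          (Homeomorph.measurableEmbedding _)]
        congr 1
        ext y
        have hy : ‖y.1‖ ≠ 0 := norm_ne_zero_iff.mpr y.2
        simp only [homeomorphUnitSphereProd_apply_snd_coe, homeomorphUnitSphereProd_apply_fst_coe]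
        rw [inner_smul_right, mul_pow, inv_pow]
        field_simp
    _ = _ := by
        rw [integral_prod_mul (μ := μ.toSphere)
          (f := fun w : Metric.sphere (0 : EuclideanSpace ℝ (Fin n)) 1 => (inner ℝ x w.1) ^ (2 * k))
          (g := fun s : Set.Ioi (0 : ℝ) => s.1 ^ (2 * k) * g s.1)]
        congr 1
        simp only [Measure.volumeIoiPow, ENNReal.ofReal]
        rw [integral_withDensity_eq_integral_smul, integral_subtype_comap measurableSet_Ioi
          fun a : ℝ ↦ Real.toNNReal (a ^ (Module.finrank ℝ (EuclideanSpace ℝ (Fin n)) - 1)) • (a ^ (2 * k) * g a)]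
        · refine setIntegral_congr_fun measurableSet_Ioi fun s hs ↦ ?_
          simp only [finrank_euclideanSpace, Fintype.card_fin]
          rw [NNReal.smul_def, Real.coe_toNNReal _ (pow_nonneg hs.out.le _), smul_eq_mul, pow_add, mul_assoc]
        · exact (measurable_subtype_coe.pow_const _).real_toNNReal


lemma cos_expand {n : ℕ} (x : EuclideanSpace ℝ (Fin n)) (g : ℝ → ℝ) (hg : Continuous g)
    (hg0 : ∀ s, 0 ≤ g s)
    (hi : Integrable (fun y : EuclideanSpace ℝ (Fin n) => Real.exp (‖x‖ * ‖y‖) * g ‖y‖)) :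
    Summable (fun k : ℕ => (∫ y : EuclideanSpace ℝ (Fin n), inner ℝ x y ^ (2 * k) * g ‖y‖)
        / (2 * k).factorial) ∧
    HasSum (fun k : ℕ => (-1) ^ k * ((∫ y : EuclideanSpace ℝ (Fin n), inner ℝ x y ^ (2 * k) * g ‖y‖)
        / (2 * k).factorial)) (∫ y : EuclideanSpace ℝ (Fin n), Real.cos (inner ℝ x y) * g ‖y‖) := by
  set b : ℕ → EuclideanSpace ℝ (Fin n) → ℝ := fun k y =>
    inner ℝ x y ^ (2 * k) / (2 * k).factorial * g ‖y‖ with hb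
  have hbc : ∀ k, Continuous (b k) := fun k => by simp only [hb]; fun_prop
  have hb0 : ∀ k y, 0 ≤ b k y := fun k y => by
    simp only [hb]
    have := hg0 ‖y‖
    have h2 : 0 ≤ inner ℝ x y ^ (2 * k) := by rw [pow_mul]; positivity
    positivity
  have hbs : ∀ y, HasSum (fun k => b k y) (Real.cosh (inner ℝ x y) * g ‖y‖) := fun y =>
    (Real.hasSum_cosh (inner ℝ x y)).mul_right _
  have hci : Integrable (fun y : EuclideanSpace ℝ (Fin n) => Real.cosh (inner ℝ x y) * g ‖y‖) := by
    refine hi.mono' (by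
      apply Continuous.aestronglyMeasurable
      fun_prop) (Eventually.of_forall fun y => ?_)
    rw [norm_mul, Real.norm_of_nonneg (hg0 _), Real.norm_of_nonneg (Real.cosh_pos _).le]
    gcongr
    · exact hg0 _
    · have h1 : |inner ℝ x y| ≤ ‖x‖ * ‖y‖ := abs_real_inner_le_norm x y
      rw [← Real.cosh_abs, Real.cosh_eq]
      have h2 : Real.exp |inner ℝ x y| ≤ Real.exp (‖x‖ * ‖y‖) := Real.exp_le_exp.mpr h1
      have h3 : Real.exp (-|inner ℝ x y|) ≤ Real.exp |inner ℝ x y| := Real.exp_le_exp.mpr (by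
        linarith [abs_nonneg (inner ℝ x y)])
      linarith
  have hti : Integrable (fun y => ∑' k, b k y) := by
    simpa only [(hbs _).tsum_eq] using hci
  have eI : ∀ k, ∫ y, b k y = (∫ y : EuclideanSpace ℝ (Fin n), inner ℝ x y ^ (2 * k) * g ‖y‖)
        / (2 * k).factorial := fun k => by
    rw [← integral_div]
    congr 1
    ext y
    simp only [hb]
    ring
  constructor
  · have h := hasSum_integral_of_dominated_convergence (μ := volume) b
      (F := b) (f := fun y => Real.cosh (inner ℝ x y) * g ‖y‖)
      (fun k => (hbc k).aestronglyMeasurable)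
      (fun k => Eventually.of_forall fun y => (Real.norm_of_nonneg (hb0 k y)).le)
      (Eventually.of_forall fun y => (hbs y).summable) hti
      (Eventually.of_forall hbs)
    simpa only [eI] using h.summable
  · have h := hasSum_integral_of_dominated_convergence (μ := volume) b
      (F := fun k y => (-1) ^ k * b k y) (f := fun y => Real.cos (inner ℝ x y) * g ‖y‖)
      (fun k => ((hbc k).const_mul _).aestronglyMeasurable)
      (fun k => Eventually.of_forall fun y => by simp [Real.norm_of_nonneg (hb0 k y)])
      (Eventually.of_forall fun y => (hbs y).summable) hti
      (Eventually.of_forall fun y => by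
        have := (Real.hasSum_cos (inner ℝ x y)).mul_right (g ‖y‖)
        refine this.congr_fun ?_
        intro k
        simp only [hb]
        ring)
    simpa only [integral_const_mul, eI] using h

lemma integrable_gauss {n : ℕ} (c : ℝ) (hc : 0 < c) :
    Integrable (fun y : EuclideanSpace ℝ (Fin n) => Real.exp (-(c * ‖y‖ ^ 2))) := by
  have h := (GaussianFourier.integrable_cexp_neg_mul_sq_norm_add (V := EuclideanSpace ℝ (Fin n))
    (b := (c : ℂ)) (by simpa using hc) 0 0).norm
  refine h.congr (Eventually.of_forall fun y => ?_)
  simp only [Complex.norm_exp]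
  congr 1
  simp [← Complex.ofReal_pow]

lemma integrable_exp_gauss {n : ℕ} (a : ℝ) :
    Integrable (fun y : EuclideanSpace ℝ (Fin n) => Real.exp (a * ‖y‖) * Real.exp (-(‖y‖ ^ 2))) := by
  refine ((integrable_gauss (n := n) (1/2) (by norm_num)).const_mul (Real.exp (a ^ 2 / 2))).mono'
    (by apply Continuous.aestronglyMeasurable; fun_prop) (Eventually.of_forall fun y => ?_)
  rw [← Real.exp_add, ← Real.exp_add, Real.norm_of_nonneg (Real.exp_pos _).le]
  apply Real.exp_le_exp.mpr
  nlinarith [sq_nonneg (a - ‖y‖)]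

lemma integrable_exp_four {n : ℕ} (a : ℝ) :
    Integrable (fun y : EuclideanSpace ℝ (Fin n) => Real.exp (a * ‖y‖) * Real.exp (-(‖y‖ ^ 4))) := by
  refine ((integrable_exp_gauss (n := n) a).const_mul (Real.exp 1)).mono'
    (by apply Continuous.aestronglyMeasurable; fun_prop) (Eventually.of_forall fun y => ?_)
  rw [← Real.exp_add, ← Real.exp_add, ← Real.exp_add, Real.norm_of_nonneg (Real.exp_pos _).le]
  apply Real.exp_le_exp.mpr
  nlinarith [sq_nonneg (‖y‖ ^ 2 - 1), sq_nonneg (‖y‖ ^ 2)]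

lemma integral_cos_gauss {n : ℕ} (x : EuclideanSpace ℝ (Fin n)) :
    ∫ y : EuclideanSpace ℝ (Fin n), Real.cos (inner ℝ x y) * Real.exp (-(‖y‖ ^ 2)) =
      π ^ ((n : ℝ) / 2) * Real.exp (-(‖x‖ ^ 2 / 4)) := by
  have h := GaussianFourier.integral_cexp_neg_mul_sq_norm_add (V := EuclideanSpace ℝ (Fin n))
    (b := 1) (by simp) Complex.I x
  have hi := GaussianFourier.integrable_cexp_neg_mul_sq_norm_add (V := EuclideanSpace ℝ (Fin n))
    (b := 1) (by simp) Complex.I x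
  have h2 := congrArg Complex.re h
  have h3 : RCLike.re (∫ v : EuclideanSpace ℝ (Fin n),
    Complex.exp (-1 * ‖v‖ ^ 2 + Complex.I * (inner ℝ x v : ℝ))) = _ := (integral_re hi).symm
  have h4 : (RCLike.re : ℂ → ℝ) = Complex.re := rfl
  rw [h4] at h3
  rw [h3] at h2
  convert h2 using 1
  · congr 1
    ext y
    simp only [Complex.exp_re]
    simp [← Complex.ofReal_pow, mul_comm]
  · simp only [finrank_euclideanSpace, Fintype.card_fin, Complex.I_sq, div_one, mul_one]
    have e1 : ((π : ℂ) ^ ((n : ℂ) / 2)) = ((π ^ ((n : ℝ) / 2) : ℝ) : ℂ) := by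
      rw [Complex.ofReal_cpow pi_pos.le]; simp
    have e2 : Complex.exp (-1 * (‖x‖ : ℂ) ^ 2 / 4) = ((Real.exp (-(‖x‖ ^ 2 / 4)) : ℝ) : ℂ) := by
      rw [Complex.ofReal_exp]; congr 1; push_cast; ring
    rw [e1, e2, ← Complex.ofReal_mul, Complex.ofReal_re]

lemma even_series_unique (a b : ℕ → ℝ) (F : ℝ → ℝ) (ha : ∀ t, HasSum (fun k => a k * t ^ (2 * k)) (F t))
    (hb : ∀ t, HasSum (fun k => b k * t ^ (2 * k)) (F t)) (k : ℕ) : a k = b k := by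
  obtain ⟨d, hd0, hd1⟩ : ∃ d : ℕ → ℝ, (∀ k, d (2 * k) = a k - b k) ∧ (∀ k, d (2 * k + 1) = 0) :=
    ⟨fun j => if Even j then a (j / 2) - b (j / 2) else 0, by simp, by simp⟩
  have hs : ∀ t : ℝ, HasSum (fun j : ℕ => t ^ j • d j) 0 := fun t => by
    have h1 : HasSum (fun k : ℕ => t ^ (2 * k) • d (2 * k)) 0 := by
      have := (ha t).sub (hb t)
      rw [sub_self] at this
      refine this.congr_fun ?_
      intro k
      rw [hd0, smul_eq_mul]
      ring
    have h2 : HasSum (fun k : ℕ => t ^ (2 * k + 1) • d (2 * k + 1)) 0 := by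
      simp only [hd1, smul_zero]
      exact hasSum_zero
    have h3 := HasSum.even_add_odd (f := fun j : ℕ => t ^ j • d j) h1 h2
    rwa [add_zero] at h3
  set p := FormalMultilinearSeries.ofScalars ℝ d
  have hp : HasFPowerSeriesAt (0 : ℝ → ℝ) p 0 := by
    rw [hasFPowerSeriesAt_iff]
    refine Eventually.of_forall fun z => ?_
    simpa [p, FormalMultilinearSeries.coeff_ofScalars] using hs z
  have h0 := hp.eq_zero
  have h1 : p.coeff (2 * k) = 0 := by rw [h0]; rfl
  simp only [p, FormalMultilinearSeries.coeff_ofScalars] at h1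
  rw [hd0] at h1
  linarith

lemma sphA_eq (n k : ℕ) (hn : 1 ≤ n) (x : EuclideanSpace ℝ (Fin n)) :
    sphA n k x = 2 * π ^ ((n : ℝ) / 2) * ‖x‖ ^ (2 * k) * (2 * k).factorial /
      (4 ^ k * k.factorial * Real.Gamma (k + (n : ℝ) / 2)) := by
  have hnp : (0 : ℝ) < n := by exact_mod_cast hn
  have hG : 0 < Real.Gamma (k + (n : ℝ) / 2) := Real.Gamma_pos_of_pos (by positivity)
  have hm := moment_polar n k hn x (fun s => Real.exp (-(s ^ 2)))
  have hI : ∫ s in Set.Ioi (0 : ℝ), s ^ (n - 1 + 2 * k) * Real.exp (-(s ^ 2)) =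
      1 / 2 * Real.Gamma (k + (n : ℝ) / 2) := by
    have := integral_rpow_mul_exp_neg_rpow (p := 2) (q := ((n - 1 + 2 * k : ℕ) : ℝ)) (by norm_num)
      (by have : (0 : ℝ) ≤ ((n - 1 + 2 * k : ℕ) : ℝ) := by positivity
          linarith)
    simp only [Real.rpow_natCast, Real.rpow_ofNat] at this
    rw [this]
    congr 2
    push_cast [hn]
    ring
  rw [hI] at hm
  have hu := even_series_unique
    (fun k => (-1) ^ k * ((∫ y : EuclideanSpace ℝ (Fin n), inner ℝ x y ^ (2 * k) * Real.exp (-(‖y‖ ^ 2)))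
        / (2 * k).factorial))
    (fun k => π ^ ((n : ℝ) / 2) * ((-(‖x‖ ^ 2 / 4)) ^ k / k.factorial))
    (fun t => π ^ ((n : ℝ) / 2) * Real.exp (-(‖t • x‖ ^ 2 / 4)))
    (fun t => by
      have h := (cos_expand (t • x) (fun s => Real.exp (-(s ^ 2))) (by fun_prop)
        (fun s => (Real.exp_pos _).le) (integrable_exp_gauss _)).2
      rw [integral_cos_gauss] at h
      refine h.congr_fun fun k => ?_
      simp only [inner_smul_left, mul_pow, mul_assoc, integral_const_mul]
      simp
      ring)
    (fun t => by
      have h := (NormedSpace.expSeries_div_hasSum_exp (𝔸 := ℝ) (-(‖t • x‖ ^ 2 / 4))).mul_left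
        (π ^ ((n : ℝ) / 2))
      rw [← Real.exp_eq_exp_ℝ] at h
      refine h.congr_fun fun k => ?_
      rw [norm_smul, mul_pow, Real.norm_eq_abs, sq_abs, pow_mul,
        show -(t ^ 2 * ‖x‖ ^ 2 / 4) = (-(‖x‖ ^ 2 / 4)) * t ^ 2 by ring, mul_pow]
      ring) k
  rw [hm] at hu
  have e : (-(‖x‖ ^ 2 / 4)) ^ k = (-1) ^ k * (‖x‖ ^ (2 * k) / 4 ^ k) := by
    rw [neg_pow, div_pow, ← pow_mul]
  rw [e] at hu
  have hne : ((-1 : ℝ)) ^ k ≠ 0 := by simp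
  have hu2 : sphA n k x * (1 / 2 * Real.Gamma (k + (n : ℝ) / 2)) / (2 * k).factorial =
      π ^ ((n : ℝ) / 2) * (‖x‖ ^ (2 * k) / 4 ^ k / k.factorial) := by
    apply mul_left_cancel₀ hne
    rw [hu]; ring
  have hf1 : ((2 * k).factorial : ℝ) ≠ 0 := by positivity
  have hf2 : (k.factorial : ℝ) ≠ 0 := by positivity
  rw [eq_div_iff (by positivity)]
  generalize Real.Gamma (k + (n : ℝ) / 2) = Γ' at *
  field_simp at hu2
  linarith


lemma bessel_term (n k : ℕ) (hn : 1 ≤ n) (η s : ℝ) (hη : 0 < η) (hs : 0 < s) :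
    Real.exp (-(s ^ (2 * 2))) * (η * s) ^ ((n : ℝ) / 2) *
      ((-1 : ℝ) ^ k * (η * s / 2) ^ ((2 * k : ℝ) + ((n : ℝ) - 2) / 2) /
        (Nat.factorial k * Real.Gamma ((k : ℝ) + ((n : ℝ) - 2) / 2 + 1))) =
    ((-1) ^ k * (η ^ (n - 1) * (η ^ (2 * k) * 2 ^ (1 - (n : ℝ) / 2) /
      (4 ^ k * k.factorial * Real.Gamma (k + (n : ℝ) / 2))))) *
      (s ^ (n - 1 + 2 * k) * Real.exp (-(s ^ 4))) := by
  have hz : 0 < η * s := mul_pos hη hs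
  have e1 : (k : ℝ) + ((n : ℝ) - 2) / 2 + 1 = k + (n : ℝ) / 2 := by ring
  have e2 : (η * s) ^ ((n : ℝ) / 2) * (η * s / 2) ^ ((2 * k : ℝ) + ((n : ℝ) - 2) / 2) =
      (η * s) ^ (n - 1 + 2 * k) * (2 ^ (1 - (n : ℝ) / 2) / 4 ^ k) := by
    rw [Real.div_rpow hz.le (by norm_num), ← mul_div_assoc, ← Real.rpow_add hz]
    have a1 : (n : ℝ) / 2 + ((2 * k : ℝ) + ((n : ℝ) - 2) / 2) = ((n - 1 + 2 * k : ℕ) : ℝ) := by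
      push_cast [hn]; ring
    have a2 : (2 : ℝ) ^ ((2 * k : ℝ) + ((n : ℝ) - 2) / 2) = 4 ^ k / 2 ^ (1 - (n : ℝ) / 2) := by
      rw [show (2 * k : ℝ) + ((n : ℝ) - 2) / 2 = ((2 * k : ℕ) : ℝ) - (1 - (n : ℝ) / 2) by push_cast; ring,
        Real.rpow_sub (by norm_num), Real.rpow_natCast, pow_mul]
      norm_num
    rw [a1, a2, Real.rpow_natCast]
    field_simp
  rw [e1]
  have e3 : s ^ (2 * 2) = s ^ 4 := rfl
  rw [e3]
  calc _ = Real.exp (-(s ^ 4)) * ((-1 : ℝ) ^ k / (Nat.factorial k * Real.Gamma (k + (n : ℝ) / 2))) *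
        ((η * s) ^ ((n : ℝ) / 2) * (η * s / 2) ^ ((2 * k : ℝ) + ((n : ℝ) - 2) / 2)) := by ring
    _ = _ := by
      rw [e2, mul_pow, pow_add]
      field_simp

lemma integrableOn_four (m : ℕ) :
    IntegrableOn (fun s : ℝ => s ^ m * Real.exp (-(s ^ 4))) (Set.Ioi 0) := by
  have := integrableOn_rpow_mul_exp_neg_rpow (p := 4) (s := (m : ℝ))
    (by have : (0 : ℝ) ≤ (m : ℝ) := by positivity
        linarith) (by norm_num)
  simpa only [Real.rpow_natCast, Real.rpow_ofNat] using this

lemma fmn_eq_s14 (n : ℕ) (hn : 1 ≤ n) (x : EuclideanSpace ℝ (Fin n)) (hx : x ≠ 0) :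
    fmn 2 n ‖x‖ = (2 * π) ^ (-((n : ℝ) / 2)) *
      ∫ y : EuclideanSpace ℝ (Fin n), Real.cos (inner ℝ x y) * Real.exp (-(‖y‖ ^ 4)) := by
  have hη : 0 < ‖x‖ := norm_pos_iff.mpr hx
  have hnp : (0 : ℝ) < n := by exact_mod_cast hn
  set η := ‖x‖ with hηd
  obtain ⟨hS, hH⟩ := cos_expand x (fun s => Real.exp (-(s ^ 4))) (by fun_prop)
        (fun s => (Real.exp_pos _).le) (integrable_exp_four _)
  set I : ℕ → ℝ := fun k => ∫ s in Set.Ioi (0 : ℝ), s ^ (n - 1 + 2 * k) * Real.exp (-(s ^ 4)) with hI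
  set c : ℕ → ℝ := fun k => η ^ (n - 1) * (η ^ (2 * k) * 2 ^ (1 - (n : ℝ) / 2) /
      (4 ^ k * k.factorial * Real.Gamma (k + (n : ℝ) / 2))) with hc
  set κ : ℝ := (2 * π) ^ (-((n : ℝ) / 2)) with hκ
  have hκ2 : 2 ^ (1 - (n : ℝ) / 2) = κ * (2 * π ^ ((n : ℝ) / 2)) := by
    have h2 : (0 : ℝ) < 2 ^ ((n : ℝ) / 2) := by positivity
    have h3 : (0 : ℝ) < π ^ ((n : ℝ) / 2) := by positivity
    rw [hκ, Real.rpow_neg (by positivity), Real.mul_rpow (by norm_num) pi_pos.le,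
      Real.rpow_sub (by norm_num), Real.rpow_one]
    field_simp
  have hc0 : ∀ k, 0 ≤ c k := fun k => by
    have hG : 0 < Real.Gamma (k + (n : ℝ) / 2) := Real.Gamma_pos_of_pos (by positivity)
    simp only [hc]; positivity
  have hcI : ∀ k, c k * I k = η ^ (n - 1) * κ *
      ((∫ y : EuclideanSpace ℝ (Fin n), inner ℝ x y ^ (2 * k) * Real.exp (-(‖y‖ ^ 4)))
        / (2 * k).factorial) := fun k => by
    have hG : 0 < Real.Gamma (k + (n : ℝ) / 2) := Real.Gamma_pos_of_pos (by positivity)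
    have hf1 : ((2 * k).factorial : ℝ) ≠ 0 := by positivity
    rw [moment_polar n k hn x (fun s => Real.exp (-(s ^ 4))), sphA_eq n k hn]
    simp only [hc, hI, hκ2, ← hηd]
    generalize Real.Gamma (k + (n : ℝ) / 2) = Γ' at *
    field_simp
  set F : ℕ → ℝ → ℝ := fun k s => ((-1) ^ k * c k) * (s ^ (n - 1 + 2 * k) * Real.exp (-(s ^ 4))) with hF
  have h := hasSum_integral_of_summable_integral_norm (μ := volume.restrict (Set.Ioi (0 : ℝ)))
    (F := F) (fun k => (integrableOn_four _).const_mul _) (by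
      have : ∀ k, ∫ s in Set.Ioi (0 : ℝ), ‖F k s‖ = η ^ (n - 1) * κ *
        ((∫ y : EuclideanSpace ℝ (Fin n), inner ℝ x y ^ (2 * k) * Real.exp (-(‖y‖ ^ 4)))
        / (2 * k).factorial) := fun k => by
        rw [← hcI, hI, ← integral_const_mul]
        refine setIntegral_congr_fun measurableSet_Ioi fun s hs => ?_
        have hs' : (0 : ℝ) < s := hs
        simp only [hF, norm_mul, norm_pow, norm_neg, norm_one, one_pow, one_mul]
        rw [Real.norm_of_nonneg (hc0 k), Real.norm_of_nonneg hs'.le,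
          Real.norm_of_nonneg (Real.exp_pos _).le]
      simp only [this]
      exact hS.mul_left _)
  have hFI : ∀ k, ∫ s in Set.Ioi (0 : ℝ), F k s = η ^ (n - 1) * κ * ((-1) ^ k *
      ((∫ y : EuclideanSpace ℝ (Fin n), inner ℝ x y ^ (2 * k) * Real.exp (-(‖y‖ ^ 4)))
        / (2 * k).factorial)) := fun k => by
    simp only [hF]
    rw [integral_const_mul, mul_assoc]
    have := hcI k
    simp only [hI] at this
    rw [this]
    ring
  simp only [hFI] at h
  have h2 := h.unique (hH.mul_left (η ^ (n - 1) * κ))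
  have h3 : ∫ s in Set.Ioi (0 : ℝ), Real.exp (-(s ^ (2 * 2))) * (η * s) ^ ((n : ℝ) / 2) *
        besselJ (((n : ℝ) - 2) / 2) (η * s) = ∫ s in Set.Ioi (0 : ℝ), ∑' k, F k s := by
    refine setIntegral_congr_fun measurableSet_Ioi fun s hs => ?_
    simp only [besselJ]
    rw [← tsum_mul_left]
    congr 1
    ext k
    rw [bessel_term n k hn η s hη hs]
  rw [fmn, h3, h2]
  have h4 : η ^ ((1 : ℝ) - n) * η ^ (n - 1) = 1 := by
    rw [← Real.rpow_natCast, ← Real.rpow_add hη]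
    push_cast [hn]
    ring_nf
    simp
  rw [← mul_assoc, ← mul_assoc, h4, one_mul]


lemma fmn_fourier (n : ℕ) (hn : 1 ≤ n) (x : EuclideanSpace ℝ (Fin n)) (hx : x ≠ 0) :
    fmn 2 n ‖x‖ = (2 * π) ^ (-((n : ℝ) / 2)) * ((𝓕 (Gs n)) ((2 * π)⁻¹ • x)).re := by
  rw [fmn_eq_s14 n hn x hx]
  congr 1
  rw [SchwartzMap.fourier_coe, Real.fourier_eq']
  have hi : Integrable (fun v : EuclideanSpace ℝ (Fin n) =>
      Complex.exp (↑(-2 * π * inner ℝ v ((2 * π)⁻¹ • x)) * Complex.I) • (Gs n) v) := by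
    refine (Gs n).integrable.norm.mono' (by
      apply Continuous.aestronglyMeasurable
      have := (Gs n).continuous
      fun_prop) (Eventually.of_forall fun v => ?_)
    rw [norm_smul, Complex.norm_exp_ofReal_mul_I, one_mul]
  have h3 : RCLike.re (∫ v : EuclideanSpace ℝ (Fin n),
      Complex.exp (↑(-2 * π * inner ℝ v ((2 * π)⁻¹ • x)) * Complex.I) • (Gs n) v) = _ :=
    (integral_re hi).symm
  have h4 : (RCLike.re : ℂ → ℝ) = Complex.re := rfl
  rw [h4] at h3
  rw [h3]
  congr 1
  ext v
  have e : -2 * π * inner ℝ v ((2 * π)⁻¹ • x) = - inner ℝ x v := by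
    rw [inner_smul_right, real_inner_comm]
    have := pi_pos.ne'
    field_simp
  rw [e, Gs_apply, smul_eq_mul, Complex.exp_ofReal_mul_I, Complex.re_mul_ofReal]
  simp
  exact (Complex.cos_ofReal_re _).symm

lemma fmn_ae (n : ℕ) (hn : 1 ≤ n) : (fun x : EuclideanSpace ℝ (Fin n) => fmn 2 n ‖x‖) =ᵐ[volume]
    fun x => (2 * π) ^ (-((n : ℝ) / 2)) * ((𝓕 (Gs n)) ((2 * π)⁻¹ • x)).re := by
  have : Nontrivial (EuclideanSpace ℝ (Fin n)) := by
    have : Nonempty (Fin n) := ⟨⟨0, hn⟩⟩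
    infer_instance
  have h : ∀ᵐ x : EuclideanSpace ℝ (Fin n), x ≠ 0 := by
    rw [ae_iff]
    simp
  filter_upwards [h] with x hx
  exact fmn_fourier n hn x hx

lemma fmn_integrable (n : ℕ) (hn : 1 ≤ n) (k : ℕ) :
    Integrable (fun x : EuclideanSpace ℝ (Fin n) => ‖x‖ ^ k * fmn 2 n ‖x‖) := by
  have hi : Integrable (fun x : EuclideanSpace ℝ (Fin n) => ‖x‖ ^ k * ‖(𝓕 (Gs n)) x‖) :=
    (𝓕 (Gs n)).integrable_pow_mul volume k
  have hi2 : Integrable (fun x : EuclideanSpace ℝ (Fin n) => ‖x‖ ^ k * ((𝓕 (Gs n)) x).re) := by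
    refine hi.mono' (by
      apply Continuous.aestronglyMeasurable
      have := (𝓕 (Gs n)).continuous
      fun_prop) (Eventually.of_forall fun x => ?_)
    rw [norm_mul, norm_pow, norm_norm]
    gcongr
    exact Complex.abs_re_le_norm _
  have hi3 := (hi2.comp_smul (R := (2 * π)⁻¹) (by positivity)).const_mul
    ((2 * π) ^ k * (2 * π) ^ (-((n : ℝ) / 2)))
  refine hi3.congr ?_
  filter_upwards [fmn_ae n hn] with x hx
  rw [hx, norm_smul, Real.norm_of_nonneg (by positivity), mul_pow (2 * π)⁻¹ ‖x‖ k, inv_pow]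
  have : (2 * π) ^ k ≠ 0 := by positivity
  field_simp

lemma quartic_derivs (h0 h1 h2 h3 h4 : ℝ → ℂ) (e0 : ∀ t, h0 t = ((Real.exp (-(t ^ 4)) : ℝ) : ℂ))
    (d0 : ∀ t, HasDerivAt h0 (h1 t) t) (d1 : ∀ t, HasDerivAt h1 (h2 t) t)
    (d2 : ∀ t, HasDerivAt h2 (h3 t) t) (d3 : ∀ t, HasDerivAt h3 (h4 t) t) : h4 0 = -24 := by
  have hE : ∀ t : ℝ, HasDerivAt (fun t : ℝ => Real.exp (-(t ^ 4))) (-4 * t ^ 3 * Real.exp (-(t ^ 4))) t := by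
    intro t
    exact ((hasDerivAt_pow 4 t).fun_neg).exp.congr_deriv (by norm_num; ring)
  have step : ∀ (h h' : ℝ → ℂ) (p p' : ℝ → ℝ), (∀ t, h t = ((p t * Real.exp (-(t ^ 4)) : ℝ) : ℂ)) →
      (∀ t, HasDerivAt p (p' t) t) → (∀ t, HasDerivAt h (h' t) t) →
      ∀ t, h' t = (((p' t - 4 * t ^ 3 * p t) * Real.exp (-(t ^ 4)) : ℝ) : ℂ) := by
    intro h h' p p' e dp dh t
    have hfun : h = fun t => ((p t * Real.exp (-(t ^ 4)) : ℝ) : ℂ) := funext e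
    have := ((dp t).mul (hE t)).ofReal_comp
    rw [hfun] at dh
    rw [(dh t).unique this]
    congr 1
    ring
  have s1 := step h0 h1 (fun _ => 1) (fun _ => 0) (by simpa using e0)
    (fun t => hasDerivAt_const t 1) d0
  have s2 := step h1 h2 (fun t => -4 * t ^ 3) (fun t => -12 * t ^ 2)
    (fun t => by rw [s1]; ring_nf)
    (fun t => by
      exact ((hasDerivAt_pow 3 t).const_mul (-4)).congr_deriv (by norm_num; ring)) d1
  have s3 := step h2 h3 (fun t => -12 * t ^ 2 + 16 * t ^ 6) (fun t => -24 * t + 96 * t ^ 5)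
    (fun t => by rw [s2]; ring_nf)
    (fun t => by
      exact (((hasDerivAt_pow 2 t).const_mul (-12)).add
        ((hasDerivAt_pow 6 t).const_mul 16)).congr_deriv (by norm_num; ring)) d2
  have s4 := step h3 h4 (fun t => -24 * t + 96 * t ^ 5 + 48 * t ^ 5 - 64 * t ^ 9)
    (fun t => -24 + 480 * t ^ 4 + 240 * t ^ 4 - 576 * t ^ 8)
    (fun t => by rw [s3]; ring_nf)
    (fun t => by
      exact (((((hasDerivAt_id t).const_mul (-24)).add ((hasDerivAt_pow 5 t).const_mul 96)).add
        ((hasDerivAt_pow 5 t).const_mul 48)).sub ((hasDerivAt_pow 9 t).const_mul 64)).congr_deriv (by norm_num; ring)) d3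
  rw [s4]
  simp

lemma line_deriv_four (n : ℕ) (e : EuclideanSpace ℝ (Fin n)) (he : ‖e‖ = 1) :
    (∂_{e} (∂_{e} (∂_{e} (∂_{e} (Gs n))))) 0 = -24 := by
  have key : ∀ (f : 𝓢(EuclideanSpace ℝ (Fin n), ℂ)) (t : ℝ),
      HasDerivAt (fun t : ℝ => f (t • e)) ((∂_{e} f) (t • e)) t := by
    intro f t
    rw [SchwartzMap.lineDerivOp_apply_eq_fderiv]
    have h1 : HasDerivAt (fun t : ℝ => t • e) e t := by
      simpa using (hasDerivAt_id t).smul_const e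
    exact (f.differentiableAt (x := t • e)).hasFDerivAt.comp_hasDerivAt t h1
  have := quartic_derivs _ _ _ _ _ (fun t => by
    rw [Gs_apply, norm_smul, he, mul_one, Real.norm_eq_abs]
    congr 3
    exact (by decide : Even 4).pow_abs t) (key (Gs n)) (key _) (key _) (key _)
  simpa using this

lemma fourier_four (n : ℕ) (e : EuclideanSpace ℝ (Fin n)) (w : EuclideanSpace ℝ (Fin n)) :
    (𝓕 (∂_{e} (∂_{e} (∂_{e} (∂_{e} (Gs n)))))) w =
      (((2 * π) ^ 4 * inner ℝ e w ^ 4 : ℝ) : ℂ) * (𝓕 (Gs n)) w := by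
  have ht : (fun x : EuclideanSpace ℝ (Fin n) => (inner ℝ x e : ℝ)).HasTemperateGrowth :=
    Function.hasTemperateGrowth_inner_left e
  have key : ∀ (f : 𝓢(EuclideanSpace ℝ (Fin n), ℂ)), (𝓕 (∂_{e} f)) w =
      (2 * π * Complex.I) * ((inner ℝ e w : ℝ) * (𝓕 f) w) := by
    intro f
    rw [SchwartzMap.fourier_lineDerivOp_eq]
    rw [smul_apply, SchwartzMap.smulLeftCLM_apply_apply ht, smul_eq_mul, real_inner_comm]
    rfl
  rw [key, key, key, key]
  push_cast
  linear_combination (2 * π) ^ 4 * ((inner ℝ e w : ℝ) : ℂ) ^ 4 * (𝓕 (Gs n)) w * (Complex.I_pow_four)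

lemma integral_inner_four (n : ℕ) (e : EuclideanSpace ℝ (Fin n)) (he : ‖e‖ = 1) :
    ∫ w : EuclideanSpace ℝ (Fin n), inner ℝ e w ^ 4 * ((𝓕 (Gs n)) w).re < 0 := by
  set H := ∂_{e} (∂_{e} (∂_{e} (∂_{e} (Gs n))))
  have h1 : 𝓕⁻ (𝓕 H) = H := FourierTransform.fourierInv_fourier_eq H
  have h2 : (𝓕⁻ (𝓕 H)) 0 = -24 := by rw [h1]; exact line_deriv_four n e he
  rw [SchwartzMap.fourierInv_coe, Real.fourierInv_eq'] at h2
  simp only [inner_zero_right, mul_zero, Complex.ofReal_zero, zero_mul, Complex.exp_zero, one_smul] at h2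
  have hi : Integrable (fun w => (𝓕 H) w) := (𝓕 H).integrable
  have h3 : RCLike.re (∫ w, (𝓕 H) w) = _ := (integral_re hi).symm
  rw [h2] at h3
  have h4 : ∀ w, RCLike.re ((𝓕 H) w) = (2 * π) ^ 4 * (inner ℝ e w ^ 4 * ((𝓕 (Gs n)) w).re) := by
    intro w
    rw [fourier_four, RCLike.re_eq_complex_re, Complex.re_ofReal_mul]
    ring
  simp only [h4, integral_const_mul] at h3
  have h5 : (RCLike.re (-24 : ℂ) : ℝ) = -24 := by simp
  rw [h5] at h3
  have : (0 : ℝ) < (2 * π) ^ 4 := by positivity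
  by_contra hcon
  push Not at hcon
  nlinarith [mul_nonneg this.le hcon]

lemma moment_four_neg (n : ℕ) (hn : 1 ≤ n) :
    ∫ x : EuclideanSpace ℝ (Fin n), ‖x‖ ^ 4 * fmn 2 n ‖x‖ < 0 := by
  obtain ⟨e, he⟩ : ∃ e : EuclideanSpace ℝ (Fin n), ‖e‖ = 1 :=
    ⟨EuclideanSpace.single ⟨0, hn⟩ 1, by simp⟩
  have hnp : (0 : ℝ) < n := by exact_mod_cast hn
  have h1 : ∫ x : EuclideanSpace ℝ (Fin n), inner ℝ e x ^ 4 * fmn 2 n ‖x‖ < 0 := by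
    have hae : (fun x : EuclideanSpace ℝ (Fin n) => inner ℝ e x ^ 4 * fmn 2 n ‖x‖) =ᵐ[volume]
      fun x => ((2 * π) ^ 4 * (2 * π) ^ (-((n : ℝ) / 2))) *
        (inner ℝ e ((2 * π)⁻¹ • x) ^ 4 * ((𝓕 (Gs n)) ((2 * π)⁻¹ • x)).re) := by
      filter_upwards [fmn_ae n hn] with x hx
      rw [hx, inner_smul_right, mul_pow (2 * π)⁻¹ _ 4, inv_pow]
      have : (2 * π) ^ 4 ≠ 0 := by positivity
      field_simp
    have hneg := integral_inner_four n e he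
    generalize 𝓕 (Gs n) = Φ at hae hneg
    have hsc := Measure.integral_comp_smul (volume : Measure (EuclideanSpace ℝ (Fin n)))
      (fun w => inner ℝ e w ^ 4 * (Φ w).re) (2 * π)⁻¹
    rw [integral_congr_ae hae, integral_const_mul, hsc]
    rw [smul_eq_mul, ← mul_assoc]
    have hp := pi_pos
    exact mul_neg_of_pos_of_neg (by positivity) hneg
  have h2 := moment_polar n 2 hn e (fmn 2 n)
  have h3 := moment_polar n 0 hn e (fun s => s ^ 4 * fmn 2 n s)
  have h4 : ∫ s in Set.Ioi (0 : ℝ), s ^ (n - 1 + 2 * 0) * (s ^ 4 * fmn 2 n s) =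
      ∫ s in Set.Ioi (0 : ℝ), s ^ (n - 1 + 2 * 2) * fmn 2 n s := by
    congr 1
    ext s
    rw [pow_add s (n - 1) (2 * 2)]
    ring
  rw [h4] at h3
  simp only [mul_zero, pow_zero, one_mul] at h3
  rw [h3]
  rw [show (4 : ℕ) = 2 * 2 from rfl, h2] at h1
  have hG : ∀ k : ℕ, 0 < Real.Gamma (k + (n : ℝ) / 2) := fun k => Real.Gamma_pos_of_pos (by positivity)
  have hA : ∀ k, 0 < sphA n k e := fun k => by
    rw [sphA_eq n k hn, he]
    have := hG k
    have := pi_pos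
    positivity
  have hR : ∫ s in Set.Ioi (0 : ℝ), s ^ (n - 1 + 2 * 2) * fmn 2 n s < 0 := by
    by_contra hcon
    push Not at hcon
    have := mul_nonneg (hA 2).le hcon
    linarith
  exact mul_neg_of_pos_of_neg (hA 0) hR


lemma four_bound {E : Type*} [NormedAddCommGroup E] [NormedSpace ℝ E] (a b : ℝ) (ha : 0 ≤ a)
    (ha1 : a ≤ 1) (hb : 0 ≤ b) (hb1 : b ≤ 1) (w z : E) :
    ‖a • w + b • z‖ ^ 4 ≤ 8 * (‖w‖ ^ 4 + ‖z‖ ^ 4) := by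
  have h1 : ‖a • w + b • z‖ ≤ ‖w‖ + ‖z‖ := by
    refine (norm_add_le _ _).trans ?_
    rw [norm_smul, norm_smul, Real.norm_of_nonneg ha, Real.norm_of_nonneg hb]
    nlinarith [norm_nonneg w, norm_nonneg z]
  calc ‖a • w + b • z‖ ^ 4 ≤ (‖w‖ + ‖z‖) ^ 4 := by gcongr
    _ ≤ _ := by
      have := add_pow_le (norm_nonneg w) (norm_nonneg z) 4
      norm_num at this; exact this

lemma bound_integrable {n : ℕ} (f u₀ : EuclideanSpace ℝ (Fin n) → ℝ)
    (hf : Integrable f) (hf4 : Integrable (fun z => ‖z‖ ^ 4 * f z))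
    (hu : Integrable u₀) (hu4 : Integrable (fun z => ‖z‖ ^ 4 * u₀ z))
    : Integrable (fun p : EuclideanSpace ℝ (Fin n) × EuclideanSpace ℝ (Fin n) =>
    8 * (‖p.2‖ ^ 4 + ‖p.1‖ ^ 4) * ‖f p.1 * u₀ p.2‖) := by
  have h1 := (hf.mul_prod hu4).norm
  have h2 := (hf4.mul_prod hu).norm
  refine ((h1.add h2).const_mul 8).congr (Eventually.of_forall fun p => ?_)
  simp only [Pi.add_apply, norm_mul, norm_pow, norm_norm]
  ring

lemma integrand_meas {n : ℕ} (f u₀ : EuclideanSpace ℝ (Fin n) → ℝ)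
    (hf : Integrable f) (hu : Integrable u₀)
    (a b : ℝ) :
    AEStronglyMeasurable (fun p : EuclideanSpace ℝ (Fin n) × EuclideanSpace ℝ (Fin n) =>
    ‖a • p.2 + b • p.1‖ ^ 4 * (f p.1 * u₀ p.2)) := by
  refine AEStronglyMeasurable.mul ?_ (hf.mul_prod hu).aestronglyMeasurable
  apply Continuous.aestronglyMeasurable
  fun_prop

lemma integrand_bound {n : ℕ} (f u₀ : EuclideanSpace ℝ (Fin n) → ℝ)
    (a b : ℝ) (ha : 0 ≤ a) (ha1 : a ≤ 1) (hb : 0 ≤ b) (hb1 : b ≤ 1)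
    (p : EuclideanSpace ℝ (Fin n) × EuclideanSpace ℝ (Fin n)) :
    ‖‖a • p.2 + b • p.1‖ ^ 4 * (f p.1 * u₀ p.2)‖ ≤ 8 * (‖p.2‖ ^ 4 + ‖p.1‖ ^ 4) * ‖f p.1 * u₀ p.2‖ := by
  rw [norm_mul, norm_pow, norm_norm]
  gcongr
  exact four_bound a b ha ha1 hb hb1 _ _

lemma conv_moment {n : ℕ} (f u₀ : EuclideanSpace ℝ (Fin n) → ℝ)
    (hf : Integrable f) (hf4 : Integrable (fun z => ‖z‖ ^ 4 * f z))
    (hu : Integrable u₀) (hu4 : Integrable (fun z => ‖z‖ ^ 4 * u₀ z))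
    (c r : ℝ) (hc : 0 ≤ c) (hc1 : c ≤ 1) (hr : 0 ≤ c * r) (hr1 : c * r ≤ 1) :
    ∫ x : EuclideanSpace ℝ (Fin n), ‖c • x‖ ^ 4 * ∫ z, f z * u₀ (x - r • z) =
    ∫ p : EuclideanSpace ℝ (Fin n) × EuclideanSpace ℝ (Fin n),
      ‖c • p.2 + (c * r) • p.1‖ ^ 4 * (f p.1 * u₀ p.2) := by
  have hH : Integrable (fun p : EuclideanSpace ℝ (Fin n) × EuclideanSpace ℝ (Fin n) =>
      ‖c • p.2 + (c * r) • p.1‖ ^ 4 * (f p.1 * u₀ p.2)) :=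
    (bound_integrable f u₀ hf hf4 hu hu4).mono' (integrand_meas f u₀ hf hu _ _)
      (Eventually.of_forall (integrand_bound f u₀ _ _ hc hc1 hr hr1))
  have hmp : MeasurePreserving (fun p : EuclideanSpace ℝ (Fin n) × EuclideanSpace ℝ (Fin n) =>
      (p.1, p.2 - r • p.1)) (volume.prod volume) (volume.prod volume) :=
    (MeasurePreserving.id volume).skew_product (g := fun z x => x - r • z)
      (by apply Continuous.measurable; unfold Function.uncurry; fun_prop)
      (Eventually.of_forall fun z => (measurePreserving_sub_right volume (r • z)).map_eq)
  have hK := hmp.integrable_comp_of_integrable hH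
  have e : ∀ z x : EuclideanSpace ℝ (Fin n), c • (x - r • z) + (c * r) • z = c • x := by
    intro z x
    rw [smul_sub, smul_smul, sub_add_cancel]
  have hK2 : Integrable (Function.uncurry fun z x : EuclideanSpace ℝ (Fin n) =>
      ‖c • x‖ ^ 4 * (f z * u₀ (x - r • z))) (volume.prod volume) := by
    refine hK.congr (Eventually.of_forall fun p => ?_)
    simp only [Function.comp, Function.uncurry, e]
  calc _ = ∫ x : EuclideanSpace ℝ (Fin n), ∫ z, ‖c • x‖ ^ 4 * (f z * u₀ (x - r • z)) := by
        simp only [integral_const_mul]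
    _ = ∫ z, ∫ x : EuclideanSpace ℝ (Fin n), ‖c • x‖ ^ 4 * (f z * u₀ (x - r • z)) :=
        (integral_integral_swap hK2).symm
    _ = ∫ z, ∫ w : EuclideanSpace ℝ (Fin n), ‖c • w + (c * r) • z‖ ^ 4 * (f z * u₀ w) := by
        congr 1
        ext z
        have h := integral_sub_right_eq_self (μ := volume)
          (fun w : EuclideanSpace ℝ (Fin n) => ‖c • w + (c * r) • z‖ ^ 4 * (f z * u₀ w)) (r • z)
        simp only [e] at h
        exact h
    _ = _ := (integral_prod _ hH).symm



lemma vinf_moment (n : ℕ) (α : ℝ) :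
    ∫ y : EuclideanSpace ℝ (Fin n), ‖y‖ ^ 4 * vinf n α y =
      α * ((1 / 4) * ∫ z : EuclideanSpace ℝ (Fin n), ‖z‖ ^ 4 * fmn 2 n ‖z‖) := by
  have h2 : (0 : ℝ) < √2 := by positivity
  have key := Measure.integral_comp_smul (volume : Measure (EuclideanSpace ℝ (Fin n)))
    (fun z => ‖z‖ ^ 4 * fmn 2 n ‖z‖) (√2)
  rw [finrank_euclideanSpace_fin, abs_of_pos (by positivity), smul_eq_mul] at key
  have hs4 : (√2) ^ 4 = 4 := by
    rw [show (√2) ^ 4 = ((√2) ^ 2) ^ 2 by ring, Real.sq_sqrt (by norm_num)]; norm_num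
  have hp : (2 : ℝ) ^ ((n : ℝ) / 2) = (√2) ^ n := by
    rw [Real.sqrt_eq_rpow, ← Real.rpow_natCast, ← Real.rpow_mul (by norm_num)]
    congr 1; ring
  have e : ∀ y : EuclideanSpace ℝ (Fin n), ‖y‖ ^ 4 * vinf n α y =
      ((√2) ^ n * α / 4) * (‖√2 • y‖ ^ 4 * fmn 2 n ‖√2 • y‖) := by
    intro y
    rw [vinf, norm_smul, Real.norm_of_nonneg h2.le, mul_pow, hs4, hp]
    ring
  simp only [e]
  rw [integral_const_mul, key]
  field_simp

lemma v_moment {n : ℕ} (u₀ : EuclideanSpace ℝ (Fin n) → ℝ) (α τ r : ℝ)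
    (U : EuclideanSpace ℝ (Fin n) → ℝ)
    (hU : ∀ x, U x = α * ∫ z : EuclideanSpace ℝ (Fin n), fmn 2 n ‖z‖ * u₀ (x - r • z)) :
    ∫ y : EuclideanSpace ℝ (Fin n), ‖y‖ ^ 4 * (Real.exp ((n : ℝ) * τ) * U (Real.exp τ • y)) =
      α * ∫ x : EuclideanSpace ℝ (Fin n),
        ‖Real.exp (-τ) • x‖ ^ 4 * ∫ z, fmn 2 n ‖z‖ * u₀ (x - r • z) := by
  have key := Measure.integral_comp_smul (volume : Measure (EuclideanSpace ℝ (Fin n)))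
    (fun x => ‖Real.exp (-τ) • x‖ ^ 4 * ∫ z, fmn 2 n ‖z‖ * u₀ (x - r • z)) (Real.exp τ)
  rw [finrank_euclideanSpace_fin, abs_of_pos (by positivity), smul_eq_mul] at key
  have e : ∀ y : EuclideanSpace ℝ (Fin n),
      ‖y‖ ^ 4 * (Real.exp ((n : ℝ) * τ) * U (Real.exp τ • y)) =
      (Real.exp τ ^ n * α) * (‖Real.exp (-τ) • (Real.exp τ • y)‖ ^ 4 *
        ∫ z, fmn 2 n ‖z‖ * u₀ (Real.exp τ • y - r • z)) := by
    intro y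
    rw [hU, smul_smul, ← Real.exp_add, neg_add_cancel, Real.exp_zero, one_smul, Real.exp_nat_mul]
    ring
  simp only [e]
  rw [integral_const_mul, key]
  have := (Real.exp_pos τ).ne'
  field_simp

lemma br_eq (τ : ℝ) (hτ : 0 < τ) :
    Real.exp (-τ) * ((Real.exp (4 * τ) - 1) / 4) ^ ((1 : ℝ) / 4) =
      ((1 - Real.exp (-(4 * τ))) / 4) ^ ((1 : ℝ) / 4) := by
  have h1 : Real.exp (-τ) = (Real.exp (-(4 * τ))) ^ ((1 : ℝ) / 4) := by
    rw [← Real.exp_mul]; congr 1; ring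
  have h2 : 1 < Real.exp (4 * τ) := by rw [Real.one_lt_exp_iff]; linarith
  rw [h1, ← Real.mul_rpow (Real.exp_pos _).le (by linarith)]
  congr 1
  have : Real.exp (-(4 * τ)) * Real.exp (4 * τ) = 1 := by
    rw [← Real.exp_add]; simp
  linear_combination this / 4

lemma prod_limit {n : ℕ} (f u₀ : EuclideanSpace ℝ (Fin n) → ℝ)
    (hf : Integrable f) (hf4 : Integrable (fun z => ‖z‖ ^ 4 * f z))
    (hu : Integrable u₀) (hu4 : Integrable (fun z => ‖z‖ ^ 4 * u₀ z))
    (hmass : ∫ x, u₀ x = 1) (a b : ℝ → ℝ)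
    (hab : ∀ᶠ τ in atTop, 0 ≤ a τ ∧ a τ ≤ 1 ∧ 0 ≤ b τ ∧ b τ ≤ 1)
    (ha : Tendsto a atTop (𝓝 0)) (b0 : ℝ) (hb : Tendsto b atTop (𝓝 b0)) (hb0 : b0 ^ 4 = 1 / 4) :
    Tendsto (fun τ => ∫ p : EuclideanSpace ℝ (Fin n) × EuclideanSpace ℝ (Fin n),
      ‖a τ • p.2 + b τ • p.1‖ ^ 4 * (f p.1 * u₀ p.2)) atTop
      (𝓝 ((1 / 4) * ∫ z, ‖z‖ ^ 4 * f z)) := by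
  have hlim : ∫ p : EuclideanSpace ℝ (Fin n) × EuclideanSpace ℝ (Fin n),
      ‖(0 : ℝ) • p.2 + b0 • p.1‖ ^ 4 * (f p.1 * u₀ p.2) = (1 / 4) * ∫ z, ‖z‖ ^ 4 * f z := by
    have e : ∀ p : EuclideanSpace ℝ (Fin n) × EuclideanSpace ℝ (Fin n),
        ‖(0 : ℝ) • p.2 + b0 • p.1‖ ^ 4 * (f p.1 * u₀ p.2) =
        (1 / 4) * ((‖p.1‖ ^ 4 * f p.1) * u₀ p.2) := by
      intro p
      rw [zero_smul, zero_add, norm_smul, mul_pow, ← norm_pow, hb0]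
      norm_num
      ring
    simp only [e]
    rw [integral_const_mul]
    congr 1
    have := integral_prod_mul (μ := (volume : Measure (EuclideanSpace ℝ (Fin n))))
      (ν := (volume : Measure (EuclideanSpace ℝ (Fin n)))) (fun z => ‖z‖ ^ 4 * f z) u₀
    rw [hmass, mul_one] at this
    exact this
  rw [← hlim]
  refine tendsto_integral_filter_of_dominated_convergence _
    (Eventually.of_forall fun τ => integrand_meas f u₀ hf hu _ _) ?_
    (bound_integrable f u₀ hf hf4 hu hu4) (Eventually.of_forall fun p => ?_)
  · filter_upwards [hab] with τ h
    exact Eventually.of_forall (integrand_bound f u₀ _ _ h.1 h.2.1 h.2.2.1 h.2.2.2)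
  · exact (((ha.smul_const _).add (hb.smul_const _)).norm.pow 4).mul_const _


end helpers

/-- if `(1+|y|^4)u_0 ∈ L¹` and `∫u_0 = ∫v_∞ = 1`, then the fourth moment of the
Fokker–Planck rescaling `v(y,τ) = e^{nτ} u(e^τ y, (e^{4τ}-1)/4)` of the biharmonic heat flow
converges to `M_4 = ∫ |y|^4 v_∞ < 0`. -/
theorem fourth_moment_limit_negative (n : ℕ) (hn : 1 ≤ n)
    (α : ℝ) (hα : 0 < α)
    (hαdef : α⁻¹ = ∫ x : EuclideanSpace ℝ (Fin n), fmn 2 n ‖x‖)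
    (u₀ : EuclideanSpace ℝ (Fin n) → ℝ)
    (hu₀cont : Continuous u₀) (hu₀bdd : ∃ M : ℝ, ∀ x, |u₀ x| ≤ M)
    (hu₀L1 : Integrable (fun y : EuclideanSpace ℝ (Fin n) => (1 + ‖y‖ ^ 4) * u₀ y))
    (hu₀mass : (∫ x : EuclideanSpace ℝ (Fin n), u₀ x) = 1)
    (hvinfmass : (∫ y : EuclideanSpace ℝ (Fin n), vinf n α y) = 1)
    (u : EuclideanSpace ℝ (Fin n) → ℝ → ℝ)
    (hu : ∀ x t, u x t = α * ∫ z : EuclideanSpace ℝ (Fin n),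
      fmn 2 n ‖z‖ * u₀ (x - t ^ ((1 : ℝ) / 4) • z))
    (v : EuclideanSpace ℝ (Fin n) → ℝ → ℝ)
    (hv : ∀ y τ, v y τ =
      Real.exp ((n : ℝ) * τ) * u (Real.exp τ • y) ((Real.exp (4 * τ) - 1) / 4)) :
    Tendsto (fun τ : ℝ => ∫ y : EuclideanSpace ℝ (Fin n), ‖y‖ ^ 4 * v y τ) atTop
        (nhds (∫ y : EuclideanSpace ℝ (Fin n), ‖y‖ ^ 4 * vinf n α y)) ∧
      (∫ y : EuclideanSpace ℝ (Fin n), ‖y‖ ^ 4 * vinf n α y) < 0 := by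
  rw [vinf_moment]
  have hneg := moment_four_neg n hn
  refine ⟨?_, by nlinarith [mul_pos hα (neg_pos.mpr hneg)]⟩
  have hf : Integrable (fun z : EuclideanSpace ℝ (Fin n) => fmn 2 n ‖z‖) := by
    simpa using fmn_integrable n hn 0
  have hf4 := fmn_integrable n hn 4
  have hui : Integrable u₀ := by
    refine hu₀L1.norm.mono' hu₀cont.aestronglyMeasurable (Eventually.of_forall fun y => ?_)
    rw [norm_mul, Real.norm_of_nonneg (by positivity : 0 ≤ 1 + ‖y‖ ^ 4)]
    have h4 : 0 ≤ ‖y‖ ^ 4 := by positivity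
    nlinarith [norm_nonneg (u₀ y)]
  have hu4 : Integrable (fun y => ‖y‖ ^ 4 * u₀ y) := by
    refine hu₀L1.norm.mono' (Continuous.aestronglyMeasurable (by fun_prop))
      (Eventually.of_forall fun y => ?_)
    rw [norm_mul, norm_mul, Real.norm_of_nonneg (by positivity : 0 ≤ 1 + ‖y‖ ^ 4),
      Real.norm_of_nonneg (by positivity : 0 ≤ ‖y‖ ^ 4)]
    nlinarith [norm_nonneg (u₀ y)]
  set b : ℝ → ℝ := fun τ => ((1 - Real.exp (-(4 * τ))) / 4) ^ ((1 : ℝ) / 4) with hb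
  have hcond : ∀ τ : ℝ, 0 < τ → 0 ≤ Real.exp (-τ) ∧ Real.exp (-τ) ≤ 1 ∧ 0 ≤ b τ ∧ b τ ≤ 1 := by
    intro τ hτ
    have h1 : Real.exp (-(4 * τ)) ≤ 1 := by rw [Real.exp_le_one_iff]; linarith
    refine ⟨(Real.exp_pos _).le, by rw [Real.exp_le_one_iff]; linarith,
      Real.rpow_nonneg (by linarith) _, Real.rpow_le_one (by linarith) ?_ (by norm_num)⟩
    linarith [Real.exp_pos (-(4 * τ))]
  have ha : Tendsto (fun τ : ℝ => Real.exp (-τ)) atTop (𝓝 0) := Real.tendsto_exp_neg_atTop_nhds_zero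
  have hbt : Tendsto b atTop (𝓝 ((1 / 4 : ℝ) ^ ((1 : ℝ) / 4))) := by
    have h1 : Tendsto (fun τ : ℝ => Real.exp (-(4 * τ))) atTop (𝓝 0) :=
      Real.tendsto_exp_neg_atTop_nhds_zero.comp (tendsto_id.const_mul_atTop (by norm_num))
    have h2 := ((tendsto_const_nhds (x := (1 : ℝ))).sub h1).div_const 4
    rw [sub_zero] at h2
    exact h2.rpow_const (Or.inr (by norm_num))
  have hb0 : ((1 / 4 : ℝ) ^ ((1 : ℝ) / 4)) ^ 4 = 1 / 4 := by
    rw [← Real.rpow_natCast, ← Real.rpow_mul (by norm_num)]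
    norm_num
  have hmain := (prod_limit (fun z => fmn 2 n ‖z‖) u₀ hf hf4 hui hu4 hu₀mass
    (fun τ => Real.exp (-τ)) b ((eventually_gt_atTop 0).mono hcond) ha _ hbt hb0).const_mul α
  refine hmain.congr' ?_
  filter_upwards [eventually_gt_atTop 0] with τ hτ
  obtain ⟨c0, c1, b0, b1⟩ := hcond τ hτ
  simp only [hv]
  rw [v_moment u₀ α τ _ (fun x => u x ((Real.exp (4 * τ) - 1) / 4)) (fun x => hu x _)]
  have hbr := br_eq τ hτ
  rw [conv_moment (fun z => fmn 2 n ‖z‖) u₀ hf hf4 hui hu4 _ _ c0 c1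
    (by rw [hbr]; exact b0) (by rw [hbr]; exact b1), hbr]
end

section
/- Let n ≥ 1 and let u_0 : ℝ^n → ℝ be continuous, bounded and integrable, and let u(x,t) = α_n ∫_{ℝ^n} f_n(|z|) u_0(x − t^{1/4} z) dz be the solution of the biharmonic heat equation u_t + Δ²u = 0 with initial datum u_0. Then for all t > 0: (a) ∫_{ℝ^n} u(x,t) dx = ∫_{ℝ^n} u_0(x) dx (conservation of mass); (b) the map t ↦ ∫_{ℝ^n} u(x,t)² dx is differentiable on (0,∞) with d/dt ∫_{ℝ^n} u(x,t)² dx = −2 ∫_{ℝ^n} |Δu(x,t)|² dx. -/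
open MeasureTheory Real Filter Topology

noncomputable def pd {n : ℕ} (i : Fin n) (f : EuclideanSpace ℝ (Fin n) → ℝ)
    (x : EuclideanSpace ℝ (Fin n)) : ℝ :=
  fderiv ℝ f x (EuclideanSpace.single i 1)

/-- The Laplacian on `ℝⁿ` as a sum of second partial derivatives. -/
noncomputable def lap (n : ℕ) (f : EuclideanSpace ℝ (Fin n) → ℝ) :
    EuclideanSpace ℝ (Fin n) → ℝ :=
  fun x => ∑ i : Fin n, pd i (pd i f) x

open scoped FourierTransform SchwartzMap

theorem aux_plancherel {V : Type*} [NormedAddCommGroup V] [InnerProductSpace ℝ V]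
    [FiniteDimensional ℝ V] [MeasurableSpace V] [BorelSpace V] (h : V → ℂ)
    (h1 : Integrable h) (h2 : MemLp h 2) :
    ∫ x, ‖𝓕 h x‖ ^ 2 = ∫ x, ‖h x‖ ^ 2 := by
  set H : Lp ℂ 2 (volume : Measure V) := h2.toLp h with hH
  have key : (𝓕 H : Lp ℂ 2 (volume : Measure V)) =ᵐ[volume] 𝓕 h := by
    have hcont : Continuous (𝓕 h) :=
      VectorFourier.fourierIntegral_continuous Real.continuous_fourierChar continuous_inner h1
    refine ae_eq_of_integral_contDiff_smul_eq ?_ hcont.locallyIntegrable ?_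
    · exact (Lp.memLp (𝓕 H)).locallyIntegrable (by norm_num)
    intro g hg hgc
    have hgC : ContDiff ℝ (⊤ : ℕ∞) (fun x => ((g x : ℝ) : ℂ)) := Complex.ofRealCLM.contDiff.comp hg
    have hgcC : HasCompactSupport (fun x => ((g x : ℝ) : ℂ)) :=
      hgc.comp_left (g := fun x : ℝ => (x : ℂ)) (by simp)
    let φ : 𝓢(V, ℂ) := hgcC.toSchwartzMap hgC
    have e := Lp.fourier_toTemperedDistribution_eq H
    have e2 := congrArg (fun T => T φ) e
    simp only [TemperedDistribution.fourier_apply, Lp.toTemperedDistribution_apply] at e2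
    have e3 : ∫ x, 𝓕 φ x • H x = ∫ x, 𝓕 φ x • h x := by
      refine integral_congr_ae ?_
      filter_upwards [h2.coeFn_toLp] with x hx
      rw [hH, hx]
    have e4 : ∫ x, 𝓕 φ x • h x = ∫ x, φ x • 𝓕 h x := by
      have := VectorFourier.integral_fourierIntegral_smul_eq_flip (μ := (volume : Measure V))
        (ν := (volume : Measure V)) (L := innerₗ V) (f := φ) (g := h)
        Real.continuous_fourierChar continuous_inner φ.integrable h1
      rw [flip_innerₗ] at this
      exact this
    rw [e3, e4] at e2
    exact e2.symm
  have n1 : ‖(𝓕 H : Lp ℂ 2 (volume : Measure V))‖ ^ 2 = ‖H‖ ^ 2 := by rw [Lp.norm_fourier_eq]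
  have nn : ∀ f : Lp ℂ 2 (volume : Measure V), ‖f‖ ^ 2 = ∫ x, ‖f x‖ ^ 2 := by
    intro f
    have := L2.inner_def (𝕜 := ℂ) f f
    have h3 := congrArg Complex.re this
    rw [inner_self_eq_norm_sq_to_K] at h3
    have h4 : ∀ x, inner ℂ (f x) (f x) = ((‖f x‖ ^ 2 : ℝ) : ℂ) := by
      intro x; rw [inner_self_eq_norm_sq_to_K]; simp
    simp_rw [h4] at h3
    rw [integral_complex_ofReal, Complex.ofReal_re] at h3
    rw [← h3, ← Complex.ofReal_re (‖f‖ ^ 2)]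
    simp
  rw [nn, nn] at n1
  calc _ = _ := (integral_congr_ae (by filter_upwards [key] with x hx; rw [hx])).symm
    _ = _ := n1
    _ = _ := integral_congr_ae (by filter_upwards [h2.coeFn_toLp] with x hx; rw [hH, hx])

section polar
variable {V : Type*} [NormedAddCommGroup V] [InnerProductSpace ℝ V]
    [FiniteDimensional ℝ V] [MeasurableSpace V] [BorelSpace V]

theorem aux_polar [Nontrivial V] (f : V → ℝ) (hf : Integrable f) :
    ∫ x, f x = ∫ s in Set.Ioi (0:ℝ), s ^ (Module.finrank ℝ V - 1) *
      ∫ ω : Metric.sphere (0:V) 1, f (s • (ω : V)) ∂(volume : Measure V).toSphere := by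
  have mp := (volume : Measure V).measurePreserving_homeomorphUnitSphereProd
  have me := (Homeomorph.measurableEmbedding (homeomorphUnitSphereProd V))
  have e0 : ∀ x : ({0}ᶜ : Set V), f ((homeomorphUnitSphereProd V x).2.1 •
      ((homeomorphUnitSphereProd V x).1 : V)) = f x := by
    intro x
    rw [← homeomorphUnitSphereProd_symm_apply_coe, Homeomorph.symm_apply_apply]
  have i1 : Integrable (fun x : ({0}ᶜ : Set V) => f x) ((volume : Measure V).comap (↑)) := by
    have : IntegrableOn f ({0}ᶜ : Set V) := hf.integrableOn
    rwa [integrableOn_iff_comap_subtypeVal (by measurability)] at this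
  have i2 : Integrable (fun p : Metric.sphere (0:V) 1 × Set.Ioi (0:ℝ) => f (p.2.1 • (p.1 : V)))
      ((volume : Measure V).toSphere.prod (Measure.volumeIoiPow (Module.finrank ℝ V - 1))) := by
    rw [← mp.integrable_comp_emb me]
    exact i1.congr (ae_of_all _ fun x => (e0 x).symm)
  calc ∫ x, f x = ∫ x : ({(0)}ᶜ : Set V), f x ∂((volume : Measure V).comap (↑)) := by
        rw [integral_subtype_comap (measurableSet_singleton _).compl fun x ↦ f x,
          restrict_compl_singleton]
    _ = ∫ p, f (p.2.1 • (p.1 : V)) ∂((volume : Measure V).toSphere.prod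
          (Measure.volumeIoiPow (Module.finrank ℝ V - 1))) := by
        rw [← mp.integral_comp me]
        exact integral_congr_ae (ae_of_all _ fun x => (e0 x).symm)
    _ = ∫ s : Set.Ioi (0:ℝ), ∫ ω : Metric.sphere (0:V) 1, f (s.1 • (ω : V))
          ∂(volume : Measure V).toSphere ∂(Measure.volumeIoiPow (Module.finrank ℝ V - 1)) := by
        rw [integral_prod_symm _ i2]
    _ = _ := by
      simp only [Measure.volumeIoiPow, ENNReal.ofReal]
      rw [integral_withDensity_eq_integral_smul,
        integral_subtype_comap measurableSet_Ioi fun a ↦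
          Real.toNNReal (a ^ (Module.finrank ℝ V - 1)) •
          ∫ ω : Metric.sphere (0:V) 1, f (a • (ω : V)) ∂(volume : Measure V).toSphere,
        setIntegral_congr_fun measurableSet_Ioi fun x hx ↦ ?_]
      · rw [NNReal.smul_def, Real.coe_toNNReal _ (pow_nonneg hx.out.le _), smul_eq_mul]
      · exact (measurable_subtype_coe.pow_const _).real_toNNReal

theorem aux_int_pow [Nontrivial V] (j p : ℕ) (hp : 0 < p) {b : ℝ} (hb : 0 < b) :
    Integrable (fun x : V => ‖x‖ ^ j * rexp (-b * ‖x‖ ^ p)) := by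
  rw [integrable_fun_norm_addHaar (volume : Measure V) (f := fun r => r ^ j * rexp (-b * r ^ p))]
  have := integrableOn_rpow_mul_exp_neg_mul_rpow (p := p) (s := ((Module.finrank ℝ V - 1 + j : ℕ) : ℝ))
    (b := b) (by have : (0:ℝ) ≤ ((Module.finrank ℝ V - 1 + j : ℕ) : ℝ) := Nat.cast_nonneg _
                 linarith) (by exact_mod_cast hp) hb
  refine this.congr_fun (fun x hx => ?_) measurableSet_Ioi
  simp only [Real.rpow_natCast, smul_eq_mul, pow_add]
  ring

theorem aux_int_inner [Nontrivial V] (y : V) (j p : ℕ) (hp : 0 < p) {b : ℝ} (hb : 0 < b) :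
    Integrable (fun x : V => (inner ℝ y x) ^ j * rexp (-b * ‖x‖ ^ p)) := by
  refine ((aux_int_pow (V := V) j p hp hb).const_mul (‖y‖ ^ j)).mono' ?_ (ae_of_all _ fun x => ?_)
  · exact Continuous.aestronglyMeasurable (by fun_prop)
  · rw [norm_mul, norm_pow, Real.norm_of_nonneg (Real.exp_pos _).le, ← mul_assoc, ← mul_pow]
    gcongr
    exact norm_inner_le_norm y x

theorem aux_moment_succ [Nontrivial V] (y : V) (k : ℕ) :
    ∫ x : V, (inner ℝ y x) ^ (2 * (k+1)) * rexp (-1 * ‖x‖ ^ 2) =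
      ((2 * k + 1 : ℝ) / 2 * ‖y‖ ^ 2) * ∫ x : V, (inner ℝ y x) ^ (2 * k) * rexp (-1 * ‖x‖ ^ 2) := by
  have hf : ∀ x : V, HasFDerivAt (fun x : V => (inner ℝ y x) ^ (2 * k + 1))
      (((2 * k + 1 : ℕ) * (inner ℝ y x) ^ (2 * k)) • innerSL ℝ y) x := by
    intro x
    have := ((innerSL ℝ y).hasFDerivAt (x := x)).pow (2 * k + 1)
    rw [nsmul_eq_mul, Nat.add_sub_cancel] at this
    exact this
  have hg : ∀ x : V, HasFDerivAt (fun x : V => rexp (-1 * ‖x‖ ^ 2))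
      ((rexp (-1 * ‖x‖ ^ 2)) • ((-1 : ℝ) • (2 • innerSL ℝ x))) x := by
    intro x
    exact ((hasStrictFDerivAt_norm_sq x).hasFDerivAt.const_mul (-1)).exp
  have ibp := integral_mul_fderiv_eq_neg_fderiv_mul_of_integrable (μ := (volume : Measure V))
    (𝕜 := ℝ) (f := fun x : V => (inner ℝ y x) ^ (2 * k + 1))
    (g := fun x : V => rexp (-1 * ‖x‖ ^ 2)) (v := y) ?_ ?_ ?_
    (fun x _ => (hf x).differentiableAt) (fun x _ => (hg x).differentiableAt)
  · simp_rw [(hf _).fderiv, (hg _).fderiv] at ibp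
    have l : ∀ x : V, inner ℝ y x ^ (2 * k + 1) *
      ((rexp (-1 * ‖x‖ ^ 2)) • ((-1 : ℝ) • (2 • innerSL ℝ x))) y =
       -2 * ((inner ℝ y x) ^ (2 * (k+1)) * rexp (-1 * ‖x‖ ^ 2)) := by
      intro x
      simp only [smul_apply, innerSL_apply_apply, smul_eq_mul, nsmul_eq_mul]
      rw [real_inner_comm y x]; push_cast; ring
    have r : ∀ x : V, (((2 * k + 1 : ℕ) * (inner ℝ y x) ^ (2 * k)) • innerSL ℝ y) y *
       rexp (-1 * ‖x‖ ^ 2) =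
       ((2 * k + 1 : ℝ) * ‖y‖ ^ 2) * ((inner ℝ y x) ^ (2 * k) * rexp (-1 * ‖x‖ ^ 2)) := by
      intro x
      simp only [smul_apply, innerSL_apply_apply, smul_eq_mul]
      rw [real_inner_self_eq_norm_sq]; push_cast; ring
    simp_rw [l, r, integral_const_mul] at ibp
    linarith
  · simp_rw [(hf _).fderiv]
    refine ((aux_int_inner y (2*k) 2 two_pos one_pos).const_mul ((2 * k + 1 : ℝ) * ‖y‖ ^ 2)).congr
      (ae_of_all _ fun x => ?_)
    simp only [smul_apply, innerSL_apply_apply, smul_eq_mul]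
    rw [real_inner_self_eq_norm_sq]; push_cast; ring
  · simp_rw [(hg _).fderiv]
    refine ((aux_int_inner y (2*(k+1)) 2 two_pos one_pos).const_mul (-2)).congr
      (ae_of_all _ fun x => ?_)
    simp only [smul_apply, innerSL_apply_apply, smul_eq_mul, nsmul_eq_mul]
    rw [real_inner_comm y x]; push_cast; ring
  · exact aux_int_inner y (2*k+1) 2 two_pos one_pos

theorem aux_moment [Nontrivial V] (y : V) (k : ℕ) :
    ∫ x : V, (inner ℝ y x) ^ (2 * k) * rexp (-1 * ‖x‖ ^ 2) =
      π ^ (Module.finrank ℝ V / 2 : ℝ) * ((2 * k).factorial / (k.factorial * 4 ^ k)) * ‖y‖ ^ (2 * k) := by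
  induction k with
  | zero => simpa using GaussianFourier.integral_rexp_neg_mul_sq_norm (V := V) one_pos
  | succ k ih =>
    rw [aux_moment_succ, ih, show 2 * (k + 1) = 2 * k + 1 + 1 by ring, Nat.factorial_succ,
      Nat.factorial_succ, Nat.factorial_succ]
    push_cast
    field_simp
    ring

theorem aux_sphere_moment [Nontrivial V] (y : V) (k : ℕ) :
    ∫ ω : Metric.sphere (0:V) 1, (inner ℝ y (ω : V)) ^ (2 * k) ∂(volume : Measure V).toSphere =
     2 * π ^ (Module.finrank ℝ V / 2 : ℝ) / Real.Gamma (k + (Module.finrank ℝ V : ℝ) / 2) *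
       ((2 * k).factorial / (k.factorial * 4 ^ k)) * ‖y‖ ^ (2 * k) := by
  have hd : 0 < Module.finrank ℝ V := Module.finrank_pos
  obtain ⟨d, hd'⟩ : ∃ d, Module.finrank ℝ V = d + 1 := ⟨_, (Nat.succ_pred_eq_of_pos hd).symm⟩
  have h := aux_polar _ (aux_int_inner y (2*k) 2 two_pos one_pos)
  rw [aux_moment] at h
  have e : ∀ s : ℝ, s ^ (Module.finrank ℝ V - 1) *
      ∫ ω : Metric.sphere (0:V) 1, (inner ℝ y (s • (ω : V))) ^ (2 * k) * rexp (-1 * ‖s • (ω:V)‖ ^ 2)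
        ∂(volume : Measure V).toSphere = (s ^ (d + 2 * k) * rexp (- s ^ 2)) *
      ∫ ω : Metric.sphere (0:V) 1, (inner ℝ y (ω : V)) ^ (2 * k) ∂(volume : Measure V).toSphere := by
    intro s
    rw [← integral_const_mul, ← integral_const_mul]
    congr 1
    ext ω
    have : ‖(ω:V)‖ = 1 := by simp
    rw [inner_smul_right, norm_smul, this, hd', mul_pow, pow_add]
    simp
    ring
  simp_rw [e] at h
  rw [integral_mul_const] at h
  have g : ∫ s in Set.Ioi (0:ℝ), s ^ (d + 2 * k) * rexp (- s ^ 2) =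
      1 / 2 * Real.Gamma (k + (Module.finrank ℝ V : ℝ) / 2) := by
    have := integral_rpow_mul_exp_neg_rpow (p := 2) (q := ((d + 2 * k : ℕ) : ℝ)) two_pos
      (by have : (0:ℝ) ≤ ((d + 2 * k : ℕ) : ℝ) := Nat.cast_nonneg _
          linarith)
    simp only [Real.rpow_natCast, Real.rpow_two] at this
    rw [this, hd']
    congr 2
    push_cast; ring
  rw [g] at h
  have gp : 0 < Real.Gamma (k + (Module.finrank ℝ V : ℝ) / 2) := Real.Gamma_pos_of_pos (by positivity)
  have : ∀ a b c d e: ℝ, 0 < a → b * c * d = 1 / 2 * a * e → e = 2 * b / a * c * d := by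
    intro a b c d e ha h
    field_simp
    linarith
  exact this _ _ _ _ _ gp h

theorem aux_sphere_cos [Nontrivial V] (y : V) :
    HasSum (fun k : ℕ => (2 * π ^ (Module.finrank ℝ V / 2 : ℝ)) * ((-1) ^ k * ‖y‖ ^ (2 * k) /
      (4 ^ k * k.factorial * Real.Gamma (k + (Module.finrank ℝ V : ℝ) / 2))))
    (∫ ω : Metric.sphere (0:V) 1, Real.cos (inner ℝ y (ω : V)) ∂(volume : Measure V).toSphere) := by
  have h := hasSum_integral_of_dominated_convergence (μ := (volume : Measure V).toSphere)
    (F := fun (k : ℕ) (ω : Metric.sphere (0:V) 1) => (-1 : ℝ) ^ k * (inner ℝ y (ω : V)) ^ (2 * k)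
      / (2 * k).factorial)
    (f := fun ω => Real.cos (inner ℝ y (ω : V)))
    (fun k _ => ‖y‖ ^ (2 * k) / (2 * k).factorial) ?_ ?_ ?_ ?_ ?_
  · refine Eq.mpr (congrArg (fun f => HasSum f _) (funext fun k => ?_)) h
    have e : ∀ ω : Metric.sphere (0:V) 1, (-1 : ℝ) ^ k * (inner ℝ y (ω : V)) ^ (2 * k)
      / (2 * k).factorial = ((-1 : ℝ) ^ k / (2 * k).factorial) * (inner ℝ y (ω : V)) ^ (2 * k) :=
      fun ω => mul_div_right_comm _ _ _
    simp_rw [e]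
    rw [integral_const_mul, aux_sphere_moment]
    have : (0:ℝ) < (2 * k).factorial := by positivity
    field_simp
  · intro k
    exact Continuous.aestronglyMeasurable (by fun_prop)
  · intro k
    refine ae_of_all _ fun ω => ?_
    have : ‖(ω:V)‖ = 1 := by simp
    rw [norm_div, norm_mul, norm_pow, norm_pow, norm_neg, norm_one, one_pow, one_mul,
      Real.norm_natCast]
    gcongr
    simpa [this] using norm_inner_le_norm (𝕜 := ℝ) y (ω:V)
  · refine ae_of_all _ fun ω => ?_
    exact (Real.hasSum_cosh ‖y‖).summable
  · exact integrable_const _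
  · refine ae_of_all _ fun ω => ?_
    exact Real.hasSum_cos _

end polar

theorem aux_bessel (n : ℕ) (hn : 1 ≤ n) (y : ℝ) (hy : 0 < y) :
    y ^ ((n:ℝ)/2) * besselJ (((n : ℝ) - 2) / 2) y = 2 ^ (1 - (n:ℝ)/2) * y ^ (n - 1) *
      ∑' k : ℕ, ((-1) ^ k * y ^ (2 * k) / (4 ^ k * k.factorial * Real.Gamma (k + (n : ℝ) / 2))) := by
  rw [besselJ, ← tsum_mul_left, ← tsum_mul_left]
  congr 1
  ext k
  have e1 : (y / 2) ^ ((2 * k : ℝ) + ((n : ℝ) - 2) / 2) =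
      y ^ (2 * k) / 4 ^ k * (y ^ (((n : ℝ) - 2) / 2) * 2 ^ (1 - (n:ℝ)/2)) := by
    rw [Real.rpow_add (by positivity), Real.div_rpow hy.le two_pos.le,
      Real.div_rpow hy.le two_pos.le]
    rw [show (1 - (n:ℝ)/2) = -(((n : ℝ) - 2) / 2) by ring, Real.rpow_neg two_pos.le,
      show (2 * k : ℝ) = ((2 * k : ℕ) : ℝ) by push_cast; rfl, Real.rpow_natCast, Real.rpow_natCast,
      pow_mul 2, show (2:ℝ)^2 = 4 by norm_num]
    ring
  have e2 : y ^ ((n:ℝ)/2) * y ^ (((n : ℝ) - 2) / 2) = y ^ (n - 1) := by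
    rw [← Real.rpow_add hy, ← Real.rpow_natCast, Nat.cast_sub hn]
    congr 1
    push_cast; ring
  rw [e1, show (k:ℝ) + ((n:ℝ) - 2)/2 + 1 = k + (n:ℝ)/2 by ring, ← e2]
  have : (0:ℝ) < (k.factorial : ℝ) := by positivity
  have gp : 0 < Real.Gamma (k + (n : ℝ) / 2) := Real.Gamma_pos_of_pos (by positivity)
  field_simp

theorem aux_int_cos {V : Type*} [NormedAddCommGroup V] [InnerProductSpace ℝ V]
    [FiniteDimensional ℝ V] [MeasurableSpace V] [BorelSpace V] [Nontrivial V] (x : V) :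
    Integrable (fun ξ : V => rexp (-1 * ‖ξ‖ ^ 4) * Real.cos (inner ℝ x ξ)) := by
  have h := aux_int_pow (V := V) 0 4 (by norm_num) one_pos
  simp only [pow_zero, one_mul] at h
  refine h.mono' (Continuous.aestronglyMeasurable (by fun_prop)) (ae_of_all _ fun ξ => ?_)
  rw [norm_mul, Real.norm_of_nonneg (Real.exp_pos _).le]
  exact mul_le_of_le_one_right (Real.exp_pos _).le (Real.abs_cos_le_one _)

theorem aux_fmn (n : ℕ) (hn : 1 ≤ n) : ∃ c : ℝ, ∀ x : EuclideanSpace ℝ (Fin n), x ≠ 0 →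
    fmn 2 n ‖x‖ = c * ∫ ξ : EuclideanSpace ℝ (Fin n),
      rexp (-1 * ‖ξ‖ ^ 4) * Real.cos (inner ℝ x ξ) := by
  have : Nonempty (Fin n) := ⟨⟨0, hn⟩⟩
  set C : ℝ := 2 * π ^ ((n:ℝ) / 2) with hC
  have hCp : 0 < C := by positivity
  refine ⟨2 ^ (1 - (n:ℝ)/2) / C, fun x hx => ?_⟩
  have hη : 0 < ‖x‖ := norm_pos_iff.mpr hx
  rw [aux_polar _ (aux_int_cos x), fmn, ← integral_const_mul, ← integral_const_mul]
  refine setIntegral_congr_fun measurableSet_Ioi fun s hs => ?_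
  have hs : 0 < s := hs
  have hfr : Module.finrank ℝ (EuclideanSpace ℝ (Fin n)) = n := by simp
  have hsum := (aux_sphere_cos (s • x)).tsum_eq
  rw [tsum_mul_left, norm_smul, Real.norm_of_nonneg hs.le, hfr, mul_comm s] at hsum
  rw [mul_assoc, aux_bessel n hn _ (mul_pos hη hs)]
  have e : ∫ ω : Metric.sphere (0:EuclideanSpace ℝ (Fin n)) 1,
      rexp (-1 * ‖s • (ω:EuclideanSpace ℝ (Fin n))‖ ^ 4) *
        Real.cos (inner ℝ x (s • (ω:EuclideanSpace ℝ (Fin n))))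
        ∂(volume : Measure (EuclideanSpace ℝ (Fin n))).toSphere =
      rexp (- s ^ (2 * 2)) * ∫ ω : Metric.sphere (0:EuclideanSpace ℝ (Fin n)) 1,
        Real.cos (inner ℝ (s • x) (ω:EuclideanSpace ℝ (Fin n)))
        ∂(volume : Measure (EuclideanSpace ℝ (Fin n))).toSphere := by
    rw [← integral_const_mul]
    congr 1
    ext ω
    have h1 : ‖(ω:EuclideanSpace ℝ (Fin n))‖ = 1 := by simp
    rw [norm_smul, h1, inner_smul_left, inner_smul_right]
    simp [abs_of_pos hs]
  rw [e, ← hsum, hfr, ← hC, show (1:ℝ) - n = -((n - 1 : ℕ) : ℝ) by rw [Nat.cast_sub hn]; push_cast; ring,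
    Real.rpow_neg hη.le, Real.rpow_natCast, mul_pow ‖x‖ s (n-1)]
  have : 0 < ‖x‖ ^ (n-1) := by positivity
  field_simp

theorem aux_fmn_fourier (n : ℕ) (hn : 1 ≤ n) : ∃ c : ℝ, ∀ x : EuclideanSpace ℝ (Fin n), x ≠ 0 →
    ((fmn 2 n ‖x‖ : ℝ) : ℂ) = c * 𝓕 (fun ξ : EuclideanSpace ℝ (Fin n) =>
      ((rexp (-(2 * π) ^ 4 * ‖ξ‖ ^ 4) : ℝ) : ℂ)) x := by
  have : Nonempty (Fin n) := ⟨⟨0, hn⟩⟩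
  obtain ⟨c, hc⟩ := aux_fmn n hn
  refine ⟨c * (2 * π) ^ n, fun x hx => ?_⟩
  rw [hc x hx, Complex.ofReal_mul, Complex.ofReal_mul, mul_assoc]
  congr 1
  have e1 := Measure.integral_comp_smul (volume : Measure (EuclideanSpace ℝ (Fin n)))
    (fun ξ => rexp (-1 * ‖ξ‖ ^ 4) * Real.cos (inner ℝ x ξ)) (2 * π)
  have hfr : Module.finrank ℝ (EuclideanSpace ℝ (Fin n)) = n := by simp
  rw [hfr, abs_of_pos (by positivity), smul_eq_mul, ← div_eq_inv_mul, eq_div_iff (by positivity)] at e1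
  rw [← e1, mul_comm, Complex.ofReal_mul]
  congr 1
  have hint : Integrable (fun ξ : EuclideanSpace ℝ (Fin n) =>
      ((rexp (-(2 * π) ^ 4 * ‖ξ‖ ^ 4) : ℝ) : ℂ)) := by
    have h := aux_int_pow (V := EuclideanSpace ℝ (Fin n)) 0 4 (by norm_num)
      (b := (2 * π) ^ 4) (by positivity)
    simp only [pow_zero, one_mul] at h
    exact h.ofReal
  have hneg : 𝓕 (fun ξ : EuclideanSpace ℝ (Fin n) => ((rexp (-(2 * π) ^ 4 * ‖ξ‖ ^ 4) : ℝ) : ℂ)) x =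
     ∫ v : EuclideanSpace ℝ (Fin n), Complex.exp (((2 * π * inner ℝ v x : ℝ) : ℂ) * Complex.I) •
        ((rexp (-(2 * π) ^ 4 * ‖v‖ ^ 4) : ℝ) : ℂ) := by
    rw [Real.fourier_eq', ← integral_neg_eq_self]
    congr 1
    ext v
    simp
  have hpos := Real.fourier_eq' (fun ξ : EuclideanSpace ℝ (Fin n) =>
    ((rexp (-(2 * π) ^ 4 * ‖ξ‖ ^ 4) : ℝ) : ℂ)) x
  have i1 : Integrable (fun v : EuclideanSpace ℝ (Fin n) =>
      Complex.exp (((2 * π * inner ℝ v x : ℝ) : ℂ) * Complex.I) •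
        ((rexp (-(2 * π) ^ 4 * ‖v‖ ^ 4) : ℝ) : ℂ)) := by
    refine hint.norm.mono' (Continuous.aestronglyMeasurable (by fun_prop)) (ae_of_all _ fun v => ?_)
    rw [norm_smul, Complex.norm_exp_ofReal_mul_I, one_mul]
  have i2 : Integrable (fun v : EuclideanSpace ℝ (Fin n) =>
      Complex.exp (((-2 * π * inner ℝ v x : ℝ) : ℂ) * Complex.I) •
        ((rexp (-(2 * π) ^ 4 * ‖v‖ ^ 4) : ℝ) : ℂ)) := by
    refine hint.norm.mono' (Continuous.aestronglyMeasurable (by fun_prop)) (ae_of_all _ fun v => ?_)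
    rw [norm_smul, Complex.norm_exp_ofReal_mul_I, one_mul]
  have hsum : 2 * 𝓕 (fun ξ : EuclideanSpace ℝ (Fin n) =>
      ((rexp (-(2 * π) ^ 4 * ‖ξ‖ ^ 4) : ℝ) : ℂ)) x = 2 * ((∫ v : EuclideanSpace ℝ (Fin n),
      rexp (-1 * ‖(2 * π) • v‖ ^ 4) * Real.cos (inner ℝ x ((2 * π) • v)) : ℝ) : ℂ) := by
    rw [two_mul]
    nth_rewrite 1 [hneg]
    rw [hpos, ← integral_add i1 i2, ← integral_complex_ofReal, ← integral_const_mul]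
    congr 1
    ext v
    rw [norm_smul, inner_smul_right, Real.norm_of_nonneg (by positivity : 0 ≤ 2 * π),
      real_inner_comm v x, ← add_smul]
    push_cast
    rw [Complex.cos]
    simp only [smul_eq_mul]
    push_cast
    ring_nf
  have := mul_left_cancel₀ two_ne_zero hsum
  rw [this]

theorem aux_deriv_energy {V : Type*} [NormedAddCommGroup V] [InnerProductSpace ℝ V]
    [FiniteDimensional ℝ V] [MeasurableSpace V] [BorelSpace V] [Nontrivial V]
    (q : V → ℝ) (hq : Continuous q) (B : ℝ) (hB : ∀ x, |q x| ≤ B) (c : ℝ) (hc : 0 < c)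
    (t : ℝ) (ht : 0 < t) :
    HasDerivAt (fun s => ∫ x, rexp (-(2 * s * c) * ‖x‖ ^ 4) * q x)
      (∫ x, (-(2 * c) * ‖x‖ ^ 4 * rexp (-(2 * t * c) * ‖x‖ ^ 4)) * q x) t := by
  have hB0 : 0 ≤ B := (abs_nonneg _).trans (hB 0)
  refine (hasDerivAt_integral_of_dominated_loc_of_deriv_le (s := Set.Ioi (t / 2))
    (F := fun s x => rexp (-(2 * s * c) * ‖x‖ ^ 4) * q x)
    (F' := fun s x => (-(2 * c) * ‖x‖ ^ 4 * rexp (-(2 * s * c) * ‖x‖ ^ 4)) * q x)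
    (bound := fun x => (2 * c * B) * (‖x‖ ^ 4 * rexp (-(t * c) * ‖x‖ ^ 4)))
    (Ioi_mem_nhds (by linarith)) ?_ ?_ ?_ ?_ ?_ ?_).2
  · exact Eventually.of_forall fun s => Continuous.aestronglyMeasurable (by fun_prop)
  · have := aux_int_pow (V := V) 0 4 (by norm_num) (b := 2 * t * c) (by positivity)
    simp only [pow_zero, one_mul] at this
    refine (this.mul_const B).mono' (Continuous.aestronglyMeasurable (by fun_prop))
      (ae_of_all _ fun x => ?_)
    rw [norm_mul, Real.norm_of_nonneg (Real.exp_pos _).le]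
    exact mul_le_mul_of_nonneg_left (hB x) (Real.exp_pos _).le
  · exact Continuous.aestronglyMeasurable (by fun_prop)
  · refine ae_of_all _ fun x s hs => ?_
    have hs : t / 2 < s := hs
    rw [norm_mul, norm_mul, norm_mul, norm_neg, norm_pow, norm_norm,
      Real.norm_of_nonneg (by positivity : 0 ≤ 2 * c), Real.norm_of_nonneg (Real.exp_pos _).le]
    have h1 : rexp (-(2 * s * c) * ‖x‖ ^ 4) ≤ rexp (-(t * c) * ‖x‖ ^ 4) := by
      apply Real.exp_le_exp.mpr
      apply mul_le_mul_of_nonneg_right _ (by positivity)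
      nlinarith
    calc 2 * c * ‖x‖ ^ 4 * rexp (-(2 * s * c) * ‖x‖ ^ 4) * ‖q x‖ ≤
        2 * c * ‖x‖ ^ 4 * rexp (-(t * c) * ‖x‖ ^ 4) * B := by
          gcongr
          exact hB x
      _ = _ := by ring
  · exact (aux_int_pow (V := V) 4 4 (by norm_num) (by positivity)).const_mul _
  · refine ae_of_all _ fun x s hs => ?_
    have h1 : HasDerivAt (fun s : ℝ => -(2 * s * c) * ‖x‖ ^ 4) (-(2 * c) * ‖x‖ ^ 4) s := by
      have := ((hasDerivAt_id s).const_mul (-(2 * c) * ‖x‖ ^ 4))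
      rw [mul_one] at this
      refine this.congr_of_eventuallyEq (Eventually.of_forall fun y => ?_)
      simp only [id]; ring
    have h2 := h1.exp.mul_const (q x)
    rw [mul_comm (rexp _)] at h2
    exact h2

theorem aux_pd {n : ℕ} (v : EuclideanSpace ℝ (Fin n) → ℝ) (k : EuclideanSpace ℝ (Fin n) → ℂ)
    (hv : ∀ x, (v x : ℂ) = 𝓕 k x) (h0 : Integrable k) (h1 : Integrable (fun ξ => ‖ξ‖ * ‖k ξ‖))
    (i : Fin n) (x : EuclideanSpace ℝ (Fin n)) :
    (pd i v x : ℂ) = 𝓕 (fun ξ => (-(2 * π * Complex.I) * (ξ i : ℂ)) * k ξ) x := by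
  have hD := Real.hasFDerivAt_fourier h0 h1 x
  set D := 𝓕 (VectorFourier.fourierSMulRight (innerSL ℝ) k) x with hDdef
  have e : 𝓕 k = fun x => (v x : ℂ) := funext fun x => (hv x).symm
  rw [e] at hD
  have hre : HasFDerivAt v (Complex.reCLM.comp D) x := by
    exact Complex.reCLM.hasFDerivAt.comp x hD
  have hof : HasFDerivAt (fun x => (v x : ℂ)) (Complex.ofRealCLM.comp (Complex.reCLM.comp D)) x :=
    Complex.ofRealCLM.hasFDerivAt.comp x hre
  have hu := hof.unique hD
  have e1 : (pd i v x : ℂ) = D (EuclideanSpace.single i 1) := by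
    rw [pd, hre.fderiv, ← hu]
    rfl
  rw [e1, hDdef, Real.fourier_continuousLinearMap_apply]
  · refine congrArg (fun g : EuclideanSpace ℝ (Fin n) → ℂ => 𝓕 g x) (funext fun ξ => ?_)
    rw [VectorFourier.fourierSMulRight_apply]
    rw [innerSL_apply_apply, EuclideanSpace.inner_single_right]
    simp
    ring
  · refine (h1.const_mul (2 * π * ‖(innerSL ℝ : EuclideanSpace ℝ (Fin n) →L[ℝ] _)‖)).mono' ?_ (ae_of_all _ fun ξ => ?_)
    · exact h0.aestronglyMeasurable.fourierSMulRight
    · refine (VectorFourier.norm_fourierSMulRight_le _ _ _).trans (le_of_eq ?_)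
      ring

theorem aux_lap {n : ℕ} (v : EuclideanSpace ℝ (Fin n) → ℝ) (k : EuclideanSpace ℝ (Fin n) → ℂ)
    (hv : ∀ x, (v x : ℂ) = 𝓕 k x) (h0 : Integrable k) (h1 : Integrable (fun ξ => ‖ξ‖ * ‖k ξ‖))
    (h2 : Integrable (fun ξ => ‖ξ‖ ^ 2 * ‖k ξ‖)) (x : EuclideanSpace ℝ (Fin n)) :
    (lap n v x : ℂ) = 𝓕 (fun ξ => ((-(2 * π) ^ 2 * ‖ξ‖ ^ 2 : ℝ) : ℂ) * k ξ) x := by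
  have hm : ∀ i : Fin n, AEStronglyMeasurable
      (fun ξ : EuclideanSpace ℝ (Fin n) => (-(2 * π * Complex.I) * (ξ i : ℂ))) := fun i =>
    Continuous.aestronglyMeasurable (by fun_prop)
  have hnorm : ∀ (i : Fin n) (ξ : EuclideanSpace ℝ (Fin n)),
      ‖(-(2 * π * Complex.I) * (ξ i : ℂ))‖ ≤ 2 * π * ‖ξ‖ := by
    intro i ξ
    rw [norm_mul, norm_neg, norm_mul, norm_mul, Complex.norm_I, Complex.norm_real, Complex.norm_real,
      Real.norm_of_nonneg Real.pi_pos.le]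
    simp only [Complex.norm_ofNat, mul_one]
    gcongr
    exact PiLp.norm_apply_le ξ i
  have k0 : ∀ i : Fin n, Integrable (fun ξ => (-(2 * π * Complex.I) * (ξ i : ℂ)) * k ξ) := by
    intro i
    refine (h1.const_mul (2 * π)).mono' ((hm i).mul h0.aestronglyMeasurable) (ae_of_all _ fun ξ => ?_)
    rw [norm_mul, ← mul_assoc]
    gcongr
    exact hnorm i ξ
  have k1 : ∀ i : Fin n, Integrable (fun ξ => ‖ξ‖ * ‖(-(2 * π * Complex.I) * (ξ i : ℂ)) * k ξ‖) := by
    intro i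
    refine (h2.const_mul (2 * π)).mono' ((continuous_norm.aestronglyMeasurable).mul
      ((hm i).mul h0.aestronglyMeasurable).norm) (ae_of_all _ fun ξ => ?_)
    rw [norm_mul, norm_norm, norm_norm, norm_mul]
    calc ‖ξ‖ * (‖(-(2 * π * Complex.I) * (ξ i : ℂ))‖ * ‖k ξ‖) ≤ ‖ξ‖ * ((2 * π * ‖ξ‖) * ‖k ξ‖) := by
          gcongr
          exact hnorm i ξ
      _ = _ := by ring
  have k2 : ∀ i : Fin n, Integrable (fun ξ => (-(2 * π * Complex.I) * (ξ i : ℂ)) *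
      ((-(2 * π * Complex.I) * (ξ i : ℂ)) * k ξ)) := by
    intro i
    refine ((k1 i).const_mul (2 * π)).mono' ((hm i).mul (k0 i).aestronglyMeasurable) (ae_of_all _ fun ξ => ?_)
    rw [norm_mul, ← mul_assoc]
    gcongr
    exact hnorm i ξ
  have step : ∀ i : Fin n, (pd i (pd i v) x : ℂ) = 𝓕 (fun ξ => (-(2 * π * Complex.I) * (ξ i : ℂ)) *
      ((-(2 * π * Complex.I) * (ξ i : ℂ)) * k ξ)) x := fun i =>
    aux_pd (pd i v) _ (fun y => aux_pd v k hv h0 h1 i y) (k0 i) (k1 i) i x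
  rw [lap]
  push_cast
  simp_rw [step, Real.fourier_eq]
  rw [← integral_finsetSum]
  · congr 1
    ext ξ
    rw [← Finset.smul_sum]
    congr 1
    have : (‖ξ‖ : ℂ) ^ 2 = ∑ i, (ξ i : ℂ) ^ 2 := by
      rw [← Complex.ofReal_pow, EuclideanSpace.real_norm_sq_eq]
      push_cast; rfl
    push_cast
    rw [this, Finset.mul_sum, Finset.sum_mul]
    refine Finset.sum_congr rfl fun i _ => ?_
    have := Complex.I_sq
    linear_combination (4 * (π:ℂ) ^ 2 * (ξ i : ℂ) ^ 2 * k ξ) * this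
  · intro i _
    exact (Real.fourierIntegral_convergent_iff x).2 (k2 i)

theorem aux_profile (n : ℕ) (hn : 1 ≤ n) (α : ℝ) (hα : 0 < α)
    (hαdef : α⁻¹ = ∫ x : EuclideanSpace ℝ (Fin n), fmn 2 n ‖x‖) :
    Integrable (fun z : EuclideanSpace ℝ (Fin n) => α * fmn 2 n ‖z‖) ∧
    (∫ z : EuclideanSpace ℝ (Fin n), α * fmn 2 n ‖z‖) = 1 ∧
    ∀ ξ : EuclideanSpace ℝ (Fin n),
      𝓕 (fun z : EuclideanSpace ℝ (Fin n) => ((α * fmn 2 n ‖z‖ : ℝ) : ℂ)) ξ =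
        ((rexp (-(2 * π) ^ 4 * ‖ξ‖ ^ 4) : ℝ) : ℂ) := by
  have : Nonempty (Fin n) := ⟨⟨0, hn⟩⟩
  have hI : Integrable (fun z : EuclideanSpace ℝ (Fin n) => fmn 2 n ‖z‖) := by
    by_contra h
    rw [integral_undef h] at hαdef
    exact (inv_pos.2 hα).ne' hαdef
  have hF : Integrable (fun z : EuclideanSpace ℝ (Fin n) => α * fmn 2 n ‖z‖) := hI.const_mul α
  have h1 : (∫ z : EuclideanSpace ℝ (Fin n), α * fmn 2 n ‖z‖) = 1 := by
    rw [integral_const_mul, ← hαdef, mul_inv_cancel₀ hα.ne']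
  refine ⟨hF, h1, ?_⟩
  obtain ⟨c, hc⟩ := aux_fmn_fourier n hn
  set g : EuclideanSpace ℝ (Fin n) → ℂ :=
    fun ξ => ((rexp (-(2 * π) ^ 4 * ‖ξ‖ ^ 4) : ℝ) : ℂ) with hg
  set F : EuclideanSpace ℝ (Fin n) → ℂ := fun z => ((α * fmn 2 n ‖z‖ : ℝ) : ℂ) with hFdef
  have hFI : Integrable F := hF.ofReal
  have h1C : (∫ z, F z) = 1 := by
    rw [hFdef, integral_complex_ofReal, h1, Complex.ofReal_one]
  have hae : F =ᵐ[volume] fun x => ((α * c : ℝ) : ℂ) * 𝓕 g x := by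
    have : ∀ᵐ x : EuclideanSpace ℝ (Fin n), x ≠ 0 := by
      rw [ae_iff]; simp
    filter_upwards [this] with x hx
    simp only [hFdef]
    rw [Complex.ofReal_mul, hc x hx]
    push_cast; ring
  have hgc : Continuous g := by
    rw [hg]; fun_prop
  have hgI : Integrable g := by
    have := aux_int_pow (V := EuclideanSpace ℝ (Fin n)) 0 4 (by norm_num) (b := (2 * π) ^ 4) (by positivity)
    simp only [pow_zero, one_mul] at this
    exact this.ofReal
  have hne : ((α * c : ℝ) : ℂ) ≠ 0 := by
    intro h0
    rw [h0] at hae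
    rw [integral_congr_ae hae] at h1C
    simp at h1C
  have hgF : Integrable (𝓕 g) := by
    have h2 := (hFI.congr hae).const_mul ((α * c : ℝ) : ℂ)⁻¹
    refine h2.congr (ae_of_all _ fun x => ?_)
    simp only []
    rw [← mul_assoc, inv_mul_cancel₀ hne, one_mul]
  have hinv := hgc.fourierInv_fourier_eq hgI hgF
  have hFF : ∀ w, 𝓕 F w = ((α * c : ℝ) : ℂ) * g w := by
    intro w
    have e1 : 𝓕 (𝓕 g) w = g w := by
      have := congrFun hinv (-w)
      rw [Real.fourierInv_eq_fourier_neg, neg_neg] at this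
      rw [this]
      simp only [hg, norm_neg]
    rw [← e1, Real.fourier_eq, Real.fourier_eq, ← integral_const_mul]
    refine integral_congr_ae ?_
    filter_upwards [hae] with x hx
    rw [hx]
    simp only [Circle.smul_def, smul_eq_mul]
    ring
  have h0 := hFF 0
  rw [Real.fourier_eq] at h0
  simp only [inner_zero_right, neg_zero, AddChar.map_zero_eq_one, one_smul, h1C] at h0
  intro ξ
  rw [hFF ξ]
  have : g 0 = 1 := by simp [hg]
  rw [this, mul_one] at h0
  rw [← h0, one_mul]

theorem aux_solution (n : ℕ) (F u₀ v : EuclideanSpace ℝ (Fin n) → ℝ) (t : ℝ) (ht : 0 < t)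
    (hF : Integrable F)
    (hFF : ∀ ξ, 𝓕 (fun z => ((F z : ℝ) : ℂ)) ξ = ((rexp (-(2 * π) ^ 4 * ‖ξ‖ ^ 4) : ℝ) : ℂ))
    (hc : Continuous u₀) (M : ℝ) (hM : ∀ x, |u₀ x| ≤ M) (hI : Integrable u₀)
    (hv : ∀ x, v x = ∫ z, F z * u₀ (x - t ^ ((1 : ℝ) / 4) • z)) :
    Continuous v ∧ Integrable (fun x => (v x : ℂ)) ∧
    ∀ ξ, 𝓕 (fun x => (v x : ℂ)) ξ =
      ((rexp (-(t * (2 * π) ^ 4) * ‖ξ‖ ^ 4) : ℝ) : ℂ) * 𝓕 (fun x => (u₀ x : ℂ)) ξ := by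
  set r : ℝ := t ^ ((1 : ℝ) / 4) with hr
  have hr0 : 0 < r := Real.rpow_pos_of_pos ht _
  have hr4 : r ^ 4 = t := by
    rw [hr, ← Real.rpow_natCast, ← Real.rpow_mul ht.le]
    norm_num
  have hvc : Continuous v := by
    rw [funext hv]
    refine continuous_of_dominated (bound := fun z => ‖F z‖ * M) (fun x => ?_) (fun x => ae_of_all _ fun z => ?_)
      (hF.norm.mul_const M) (ae_of_all _ fun z => by fun_prop)
    · exact hF.aestronglyMeasurable.mul (Continuous.aestronglyMeasurable (by fun_prop))
    · rw [norm_mul]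
      exact mul_le_mul_of_nonneg_left (hM _) (norm_nonneg _)
  set d : ℂ := (((r ^ n)⁻¹ : ℝ) : ℂ) with hd
  set G : EuclideanSpace ℝ (Fin n) → ℂ := fun z => d * (F (r⁻¹ • z) : ℂ) with hG
  have hGI : Integrable G := ((hF.ofReal (𝕜 := ℂ)).comp_smul (inv_ne_zero hr0.ne')).const_mul d
  have huI : Integrable (fun x => (u₀ x : ℂ)) := hI.ofReal
  -- change of variables
  have hcv : ∀ f : EuclideanSpace ℝ (Fin n) → ℂ, ∫ z, d * f (r⁻¹ • z) = ∫ z, f z := by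
    intro f
    have h1 := Measure.integral_comp_inv_smul_of_nonneg volume f hr0.le
    rw [finrank_euclideanSpace_fin] at h1
    rw [integral_const_mul, h1, hd, ← Complex.real_smul, smul_smul,
      inv_mul_cancel₀ (pow_pos hr0 n).ne', one_smul]
  have hconv : (fun x => (v x : ℂ)) =
      convolution G (fun x => (u₀ x : ℂ)) (ContinuousLinearMap.mul ℂ ℂ) volume := by
    funext x
    rw [hv x, convolution_def, ← integral_complex_ofReal,
      ← hcv (fun z => ((F z * u₀ (x - r • z) : ℝ) : ℂ))]
    refine integral_congr_ae (ae_of_all _ fun z => ?_)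
    simp only [hG, ContinuousLinearMap.mul_apply', smul_smul, mul_inv_cancel₀ hr0.ne', one_smul]
    push_cast; ring
  refine ⟨hvc, ?_, fun ξ => ?_⟩
  · rw [hconv]; exact hGI.integrable_convolution _ huI
  · rw [hconv, Real.fourier_mul_convolution_eq hGI huI]
    congr 1
    have h1 := hFF (r • ξ)
    rw [norm_smul, Real.norm_of_nonneg hr0.le, mul_pow r, hr4] at h1
    rw [show -(t * (2 * π) ^ 4) * ‖ξ‖ ^ 4 = -(2 * π) ^ 4 * (t * ‖ξ‖ ^ 4) by ring, ← h1,
      Real.fourier_eq, Real.fourier_eq,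
      ← hcv (fun z => Real.fourierChar (-inner ℝ z (r • ξ)) • (F z : ℂ))]
    refine integral_congr_ae (ae_of_all _ fun z => ?_)
    have e : inner ℝ (r⁻¹ • z) (r • ξ) = inner ℝ z ξ := by
      rw [real_inner_smul_left, real_inner_smul_right, ← mul_assoc, inv_mul_cancel₀ hr0.ne', one_mul]
    simp only [hG, e, Circle.smul_def, smul_eq_mul]
    ring

theorem aux_int_bdd (n : ℕ) (hn : 1 ≤ n) (j : ℕ) (b : ℝ) (hb : 0 < b)
    (w : EuclideanSpace ℝ (Fin n) → ℂ) (hw : Continuous w) (B : ℝ) (hB : ∀ x, ‖w x‖ ≤ B) :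
    Integrable (fun x => ((‖x‖ ^ j * rexp (-b * ‖x‖ ^ 4) : ℝ) : ℂ) * w x) := by
  have : Nonempty (Fin n) := ⟨⟨0, hn⟩⟩
  have h := aux_int_pow (V := EuclideanSpace ℝ (Fin n)) j 4 (by norm_num) hb
  refine (h.mul_const B).mono' (Continuous.aestronglyMeasurable (by fun_prop))
    (ae_of_all _ fun x => ?_)
  rw [norm_mul, Complex.norm_real, Real.norm_of_nonneg (by positivity)]
  exact mul_le_mul_of_nonneg_left (hB x) (by positivity)

theorem aux_memLp_bdd (n : ℕ) (hn : 1 ≤ n) (j : ℕ) (b : ℝ) (hb : 0 < b)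
    (w : EuclideanSpace ℝ (Fin n) → ℂ) (hw : Continuous w) (B : ℝ) (hB : ∀ x, ‖w x‖ ≤ B) :
    MemLp (fun x => ((‖x‖ ^ j * rexp (-b * ‖x‖ ^ 4) : ℝ) : ℂ) * w x) 2 := by
  have hm : AEStronglyMeasurable (fun x => ((‖x‖ ^ j * rexp (-b * ‖x‖ ^ 4) : ℝ) : ℂ) * w x) :=
    Continuous.aestronglyMeasurable (by fun_prop)
  rw [memLp_two_iff_integrable_sq_norm hm]
  have h := (aux_int_bdd n hn (2 * j) (2 * b) (by positivity) (fun x => ((‖w x‖ ^ 2 : ℝ) : ℂ))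
    (by fun_prop) (B ^ 2) (fun x => ?_)).norm
  · refine h.congr (ae_of_all _ fun x => ?_)
    simp only []
    rw [norm_mul, norm_mul, Complex.norm_real, Complex.norm_real, Complex.norm_real,
      Real.norm_of_nonneg (by positivity), Real.norm_of_nonneg (by positivity),
      Real.norm_of_nonneg (by positivity),
      show -(2 * b) * ‖x‖ ^ 4 = -b * ‖x‖ ^ 4 + -b * ‖x‖ ^ 4 by ring, Real.exp_add]
    ring
  · rw [Complex.norm_real, Real.norm_of_nonneg (by positivity)]
    exact pow_le_pow_left₀ (norm_nonneg _) (hB x) 2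

/-- conservation of mass and dissipation of the `L²` norm for the biharmonic
heat flow. -/
theorem biharmonic_mass_and_energy (n : ℕ) (hn : 1 ≤ n)
    (α : ℝ) (hα : 0 < α)
    (hαdef : α⁻¹ = ∫ x : EuclideanSpace ℝ (Fin n), fmn 2 n ‖x‖)
    (u₀ : EuclideanSpace ℝ (Fin n) → ℝ)
    (hu₀cont : Continuous u₀) (hu₀bdd : ∃ M : ℝ, ∀ x, |u₀ x| ≤ M)
    (hu₀L1 : Integrable u₀)
    (u : EuclideanSpace ℝ (Fin n) → ℝ → ℝ)
    (hu : ∀ x t, u x t = α * ∫ z : EuclideanSpace ℝ (Fin n),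
      fmn 2 n ‖z‖ * u₀ (x - t ^ ((1 : ℝ) / 4) • z)) :
    (∀ t : ℝ, 0 < t →
      (∫ x : EuclideanSpace ℝ (Fin n), u x t) = ∫ x : EuclideanSpace ℝ (Fin n), u₀ x) ∧
    (∀ t : ℝ, 0 < t →
      HasDerivAt (fun s => ∫ x : EuclideanSpace ℝ (Fin n), (u x s) ^ 2)
        (-2 * ∫ x : EuclideanSpace ℝ (Fin n), |lap n (fun z => u z t) x| ^ 2) t) := by
  have : Nonempty (Fin n) := ⟨⟨0, hn⟩⟩
  obtain ⟨M, hM⟩ := hu₀bdd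
  obtain ⟨hF, h1, hFF⟩ := aux_profile n hn α hα hαdef
  have sol := fun (t : ℝ) (ht : 0 < t) => aux_solution n (fun z => α * fmn 2 n ‖z‖) u₀
    (fun x => u x t) t ht hF hFF hu₀cont M hM hu₀L1 (fun x => by
      rw [hu x t, ← integral_const_mul]
      simp only [mul_assoc])
  have four0 : ∀ w : EuclideanSpace ℝ (Fin n) → ℂ, 𝓕 w 0 = ∫ x, w x := by
    intro w
    rw [Real.fourier_eq]
    simp only [inner_zero_right, neg_zero, AddChar.map_zero_eq_one, one_smul]
  refine ⟨fun t ht => ?_, fun t ht => ?_⟩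
  · have h := (sol t ht).2.2 0
    rw [four0, four0, integral_complex_ofReal, integral_complex_ofReal] at h
    simp only [norm_zero] at h
    norm_num at h
    exact_mod_cast h
  · have huI : Integrable (fun x => (u₀ x : ℂ)) := hu₀L1.ofReal
    set w : EuclideanSpace ℝ (Fin n) → ℂ := fun ξ => 𝓕 (fun x => (u₀ x : ℂ)) (-ξ) with hw
    have hwc : Continuous w := by
      have : Continuous (𝓕 (fun x => (u₀ x : ℂ))) :=
        VectorFourier.fourierIntegral_continuous Real.continuous_fourierChar continuous_inner huI
      exact this.comp continuous_neg
    set B : ℝ := ∫ x, ‖(u₀ x : ℂ)‖ with hBdef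
    have hB : ∀ ξ, ‖w ξ‖ ≤ B := fun ξ =>
      VectorFourier.norm_fourierIntegral_le_integral_norm _ _ _ _ _
    set k : ℝ → EuclideanSpace ℝ (Fin n) → ℂ :=
      fun s ξ => ((rexp (-(s * (2 * π) ^ 4) * ‖ξ‖ ^ 4) : ℝ) : ℂ) * w ξ with hk
    have hbp : ∀ s : ℝ, 0 < s → 0 < s * (2 * π) ^ 4 := fun s hs => by positivity
    have kI : ∀ s : ℝ, 0 < s → Integrable (k s) := by
      intro s hs
      have := aux_int_bdd n hn 0 _ (hbp s hs) w hwc B hB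
      simp only [pow_zero, one_mul] at this
      exact this
    have kM : ∀ s : ℝ, 0 < s → MemLp (k s) 2 := by
      intro s hs
      have := aux_memLp_bdd n hn 0 _ (hbp s hs) w hwc B hB
      simp only [pow_zero, one_mul] at this
      exact this
    have huk : ∀ s : ℝ, 0 < s → ∀ x, (u x s : ℂ) = 𝓕 (k s) x := by
      intro s hs x
      obtain ⟨hc, hI, hf⟩ := sol s hs
      have e : 𝓕 (fun x => (u x s : ℂ)) = fun ξ => k s (-ξ) := by
        funext ξ
        rw [hf ξ]
        simp only [hk, hw, norm_neg, neg_neg]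
      have hinv := (Complex.continuous_ofReal.comp hc).fourierInv_fourier_eq hI
        (by rw [show 𝓕 (Complex.ofReal ∘ fun x => u x s) = _ from e]; exact (kI s hs).comp_neg)
      have h2 := congrFun hinv x
      rw [show 𝓕 (Complex.ofReal ∘ fun x => u x s) = _ from e,
        Real.fourierInv_eq_fourier_comp_neg] at h2
      simp only [neg_neg] at h2
      exact h2.symm
    set q : EuclideanSpace ℝ (Fin n) → ℝ := fun ξ => ‖w ξ‖ ^ 2 with hq
    have hqc : Continuous q := by rw [hq]; fun_prop
    have hqB : ∀ x, |q x| ≤ B ^ 2 := fun x => by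
      rw [hq, abs_of_nonneg (by positivity)]
      exact pow_le_pow_left₀ (norm_nonneg _) (hB x) 2
    have hc4 : (0 : ℝ) < (2 * π) ^ 4 := by positivity
    have hder := aux_deriv_energy q hqc (B ^ 2) hqB ((2 * π) ^ 4) hc4 t ht
    have hksq : ∀ s ξ, ‖k s ξ‖ ^ 2 = rexp (-(2 * s * (2 * π) ^ 4) * ‖ξ‖ ^ 4) * q ξ := by
      intro s ξ
      simp only [hk, hq]
      rw [norm_mul, Complex.norm_real, Real.norm_of_nonneg (Real.exp_pos _).le, mul_pow,
        ← Real.exp_nat_mul]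
      congr 2
      push_cast; ring
    have hE : ∀ s : ℝ, 0 < s → ∫ x, (u x s) ^ 2 =
        ∫ x, rexp (-(2 * s * (2 * π) ^ 4) * ‖x‖ ^ 4) * q x := by
      intro s hs
      have h := aux_plancherel (k s) (kI s hs) (kM s hs)
      simp only [hksq] at h
      rw [← h]
      refine integral_congr_ae (ae_of_all _ fun x => ?_)
      simp only []
      rw [← huk s hs x, Complex.norm_real, Real.norm_eq_abs, sq_abs]
    have knorm : ∀ j : ℕ, Integrable (fun ξ => ‖ξ‖ ^ j * ‖k t ξ‖) := by
      intro j
      refine (aux_int_bdd n hn j _ (hbp t ht) w hwc B hB).norm.congr (ae_of_all _ fun ξ => ?_)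
      simp only [hk]
      rw [norm_mul, norm_mul, Complex.norm_real, Complex.norm_real,
        Real.norm_of_nonneg (by positivity), Real.norm_of_nonneg (by positivity)]
      ring
    have hlap := aux_lap (fun x => u x t) (k t) (huk t ht) (kI t ht)
      (by simpa only [pow_one] using knorm 1) (knorm 2)
    set m : EuclideanSpace ℝ (Fin n) → ℂ :=
      fun ξ => ((-(2 * π) ^ 2 * ‖ξ‖ ^ 2 : ℝ) : ℂ) * k t ξ with hm
    have hmeq : m = fun ξ => ((-(2 * π) ^ 2 : ℝ) : ℂ) *
        (((‖ξ‖ ^ 2 * rexp (-(t * (2 * π) ^ 4) * ‖ξ‖ ^ 4) : ℝ) : ℂ) * w ξ) := by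
      funext ξ
      simp only [hm, hk]
      push_cast; ring
    have mI : Integrable m := by
      rw [hmeq]
      exact (aux_int_bdd n hn 2 _ (hbp t ht) w hwc B hB).const_mul _
    have mM : MemLp m 2 := by
      rw [hmeq]
      exact (aux_memLp_bdd n hn 2 _ (hbp t ht) w hwc B hB).const_mul _
    have hD : -2 * ∫ x, |lap n (fun z => u z t) x| ^ 2 =
        ∫ x, (-(2 * (2 * π) ^ 4) * ‖x‖ ^ 4 * rexp (-(2 * t * (2 * π) ^ 4) * ‖x‖ ^ 4)) * q x := by
      have h := aux_plancherel m mI mM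
      have e : ∫ x, |lap n (fun z => u z t) x| ^ 2 = ∫ x, ‖𝓕 m x‖ ^ 2 := by
        refine integral_congr_ae (ae_of_all _ fun x => ?_)
        simp only []
        rw [← hlap x, Complex.norm_real, Real.norm_eq_abs]
      rw [e, h, ← integral_const_mul]
      refine integral_congr_ae (ae_of_all _ fun x => ?_)
      simp only [hm]
      rw [norm_mul, mul_pow, hksq, Complex.norm_real, Real.norm_eq_abs, sq_abs]
      ring
    rw [hD]
    refine hder.congr_of_eventuallyEq ?_
    filter_upwards [Ioi_mem_nhds ht] with s hs
    exact hE s hs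
end
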